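/- Let a_n = n² for n ≥ 1. Let c = 1 − (1 + log log 2)/(log 2). Then for Lebesgue-almost all α ∈ [0,1] there are infinitely many N such that δ_min^α(N) ≤ (log N)^{c−1} (log₂ N)^{1/2} / N². -/

import Mathlib

open MeasureTheory Filter

/-- Distance to the nearest integer. -/
noncomputable def nint (x : ℝ) : ℝ := |x - round x|

/-- `δ_min^α(N) = min { ‖(a_m - a_n) α‖ : 1 ≤ m, n ≤ N, m ≠ n }`. -/
noncomputable def deltaMin (a : ℕ → ℕ) (α : ℝ) (N : ℕ) : ℝ :=
  sInf {x : ℝ | ∃ m n : ℕ, 1 ≤ m ∧ m ≤ N ∧ 1 ≤ n ∧ n ≤ N ∧ m ≠ n ∧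
    x = nint (((a m : ℝ) - (a n : ℝ)) * α)}

/-- `C_N = #(A_N - A_N)` where `A_N = {a_1, …, a_N}`. -/
noncomputable def diffCard (a : ℕ → ℕ) (N : ℕ) : ℕ :=
  (((Finset.Icc 1 N) ×ˢ (Finset.Icc 1 N)).image
    (fun p : ℕ × ℕ => (a p.1 : ℤ) - (a p.2 : ℤ))).card

/-- `log x`, read as `max {1, log x}`. -/
noncomputable def L (x : ℝ) : ℝ := max 1 (Real.log x)

/-- `log₂ x = log log x`, with the `max {1, ·}` convention. -/
noncomputable def LL (x : ℝ) : ℝ := L (L x)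

namespace SquareDiff

/-- The sum of the reciprocals of the primes up to `n`. -/
noncomputable def primeRecip (n : ℕ) : ℝ := ∑ p ∈ Nat.primesLE n, (1 : ℝ) / p

/-- The sum of `log p / p` over the primes `p ≤ n`. -/
noncomputable def primeLogRecip (n : ℕ) : ℝ := ∑ p ∈ Nat.primesLE n, Real.log p / p

lemma log_factorial_eq_sum (n : ℕ) :
    Real.log (n.factorial : ℝ) =
      ∑ p ∈ Nat.primesLE n, (n.factorial.factorization p : ℝ) * Real.log p := by
  rw [Real.log_nat_eq_sum_factorization]
  refine Finsupp.sum_of_support_subset _ ?_ _ (by simp)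
  intro p hp
  rw [Nat.support_factorization, Nat.mem_primeFactors] at hp
  rw [Nat.mem_primesLE]
  exact ⟨(hp.1.dvd_factorial).1 hp.2.1, hp.1⟩

lemma primeLogRecip_le (n : ℕ) (hn : 1 ≤ n) :
    primeLogRecip n ≤ Real.log n + Real.log 4 := by
  have hn0 : (0 : ℝ) < n := by exact_mod_cast hn
  have h1 : Real.log (n.factorial : ℝ) ≤ n * Real.log n := by
    rw [← Real.log_pow]
    apply Real.log_le_log (by exact_mod_cast n.factorial_pos)
    exact_mod_cast Nat.factorial_le_pow n
  have h2 : n * primeLogRecip n - Chebyshev.theta n ≤ Real.log (n.factorial : ℝ) := by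
    rw [log_factorial_eq_sum, primeLogRecip, Chebyshev.theta_eq_sum_primesLE_log, Finset.mul_sum,
      ← Finset.sum_sub_distrib]
    refine Finset.sum_le_sum fun p hp => ?_
    have hpp := Nat.prime_of_mem_primesLE hp
    have hp0 : (0 : ℝ) < p := by exact_mod_cast hpp.pos
    have hlog : 0 ≤ Real.log p := Real.log_natCast_nonneg p
    have hv : n / p ≤ n.factorial.factorization p := by
      rw [Nat.factorization_factorial hpp (Nat.lt_succ_self (Nat.log p n))]
      rcases Nat.eq_zero_or_pos (Nat.log p n) with h | h
      · have : n < p := by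
          rcases Nat.log_eq_zero_iff.1 h with h | h
          · exact h
          · have := hpp.two_le; omega
        simp [Nat.div_eq_of_lt this]
      · have : (1 : ℕ) ∈ Finset.Ico 1 (Nat.log p n).succ :=
          Finset.mem_Ico.2 ⟨le_rfl, by omega⟩
        simpa using Finset.single_le_sum (f := fun i => n / p ^ i) (fun i _ => Nat.zero_le _) this
    have hv' : (n : ℝ) / p - 1 ≤ n.factorial.factorization p := by
      have := (Nat.lt_floor_add_one ((n : ℝ) / p)).le
      rw [Nat.floor_div_natCast, Nat.floor_natCast] at this
      have h3 : ((n / p : ℕ) : ℝ) ≤ n.factorial.factorization p := by exact_mod_cast hv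
      linarith
    calc (n : ℝ) * (Real.log p / p) - Real.log p = ((n : ℝ) / p - 1) * Real.log p := by
          field_simp
      _ ≤ _ := mul_le_mul_of_nonneg_right hv' hlog
  have h3 := Chebyshev.theta_le_log4_mul_x hn0.le
  have h4 : n * primeLogRecip n ≤ n * (Real.log n + Real.log 4) := by nlinarith
  exact le_of_mul_le_mul_left h4 hn0

lemma log_sub_one_ge_factorial (n : ℕ) (hn : 1 ≤ n) :
    n * Real.log n - n ≤ Real.log (n.factorial : ℝ) := by
  have := Stirling.le_log_factorial_stirling (n := n) (by omega)
  have h1 : 0 ≤ Real.log (n : ℝ) := Real.log_natCast_nonneg n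
  have h2 : 0 ≤ Real.log (2 * Real.pi) := Real.log_nonneg (by linarith [Real.pi_gt_three])
  linarith

lemma primeLogRecip_ge : ∃ C : ℝ, ∀ n : ℕ, 1 ≤ n → Real.log n - C ≤ primeLogRecip n := by
  have hs : Summable (fun n : ℕ => 4 * (1 / (n : ℝ) ^ (3 / 2 : ℝ))) :=
    (Real.summable_one_div_nat_rpow.2 (by norm_num)).mul_left 4
  refine ⟨1 + ∑' n : ℕ, 4 * (1 / (n : ℝ) ^ (3 / 2 : ℝ)), fun n hn => ?_⟩
  have hn0 : (0 : ℝ) < n := by exact_mod_cast hn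
  set T := ∑' n : ℕ, 4 * (1 / (n : ℝ) ^ (3 / 2 : ℝ)) with hT
  have h1 : Real.log (n.factorial : ℝ) ≤ n * (primeLogRecip n + T) := by
    have : ∑ p ∈ Nat.primesLE n, 4 * (1 / (p : ℝ) ^ (3 / 2 : ℝ)) ≤ T :=
      hs.sum_le_tsum _ (fun i _ => by positivity)
    refine le_trans ?_ (mul_le_mul_of_nonneg_left (add_le_add_right this _) hn0.le)
    rw [log_factorial_eq_sum, primeLogRecip, ← Finset.sum_add_distrib, Finset.mul_sum]
    refine Finset.sum_le_sum fun p hp => ?_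
    have hpp := Nat.prime_of_mem_primesLE hp
    have : Fact p.Prime := ⟨hpp⟩
    have hp2 : (2 : ℝ) ≤ p := by exact_mod_cast hpp.two_le
    have hlog : 0 ≤ Real.log p := Real.log_natCast_nonneg p
    have hv : ((p : ℝ) - 1) * n.factorial.factorization p ≤ n := by
      have := sub_one_mul_padicValNat_factorial (p := p) n
      rw [← Nat.factorization_def _ hpp] at this
      have h3 : (p - 1) * n.factorial.factorization p ≤ n := by omega
      have h4 : (((p - 1 : ℕ) : ℝ)) * n.factorial.factorization p ≤ n := by exact_mod_cast h3
      rwa [Nat.cast_sub hpp.one_lt.le, Nat.cast_one] at h4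
    have hv2 : (n.factorial.factorization p : ℝ) ≤ n * (1 / p + 2 / p ^ 2) := by
      have h5 : (n.factorial.factorization p : ℝ) ≤ n / (p - 1) := by
        rw [le_div_iff₀ (by linarith)]; linarith
      refine h5.trans ?_
      rw [div_eq_mul_one_div]
      apply mul_le_mul_of_nonneg_left _ hn0.le
      rw [div_add_div _ _ (by positivity) (by positivity), div_le_div_iff₀ (by linarith)
        (by positivity)]
      nlinarith [mul_pos (show (0 : ℝ) < p by linarith) (show (0 : ℝ) < p by linarith)]
    have hl : Real.log p ≤ 2 * (p : ℝ) ^ (1 / 2 : ℝ) := by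
      have := Real.log_le_rpow_div (x := p) (by linarith) (ε := 1 / 2) (by norm_num)
      linarith
    have hpw : (p : ℝ) ^ (3 / 2 : ℝ) * (p : ℝ) ^ (1 / 2 : ℝ) = p ^ 2 := by
      rw [← Real.rpow_add (by linarith), ← Real.rpow_natCast]; norm_num
    have hp32 : (0 : ℝ) < (p : ℝ) ^ (3 / 2 : ℝ) := by positivity
    have hp12 : (0 : ℝ) < (p : ℝ) ^ (1 / 2 : ℝ) := by positivity
    calc (n.factorial.factorization p : ℝ) * Real.log p
        ≤ n * (1 / p + 2 / p ^ 2) * Real.log p := mul_le_mul_of_nonneg_right hv2 hlog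
      _ = n * (Real.log p / p + 2 / p ^ 2 * Real.log p) := by ring
      _ ≤ n * (Real.log p / p + 2 / p ^ 2 * (2 * (p : ℝ) ^ (1 / 2 : ℝ))) := by gcongr
      _ = _ := by
        rw [← hpw]
        congr 2
        field_simp
        norm_num
  have h2 := log_sub_one_ge_factorial n hn
  have h4 : n * Real.log n ≤ n * (primeLogRecip n + T + 1) := by linarith
  have := le_of_mul_le_mul_left h4 hn0
  linarith

lemma primesLE_succ_sum (f : ℕ → ℝ) (n : ℕ) :
    ∑ p ∈ Nat.primesLE (n + 1), f p =
      ∑ p ∈ Nat.primesLE n, f p + if (n + 1).Prime then f (n + 1) else 0 := by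
  simp only [Nat.primesLE_eq_filter_range, Finset.sum_filter]
  rw [Finset.sum_range_succ]

/-- Partial summation step relating the two prime sums. -/
lemma primeRecip_sub_succ (n : ℕ) (hn : 2 ≤ n) :
    primeRecip (n + 1) - primeLogRecip (n + 1) / Real.log ((n + 1 : ℕ) : ℝ) =
      primeRecip n - primeLogRecip n / Real.log n +
        primeLogRecip n * (1 / Real.log n - 1 / Real.log ((n + 1 : ℕ) : ℝ)) := by
  have h0 : Real.log ((n + 1 : ℕ) : ℝ) ≠ 0 :=
    (Real.log_pos (by exact_mod_cast (by omega : 1 < n + 1))).ne'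
  have h1 : ((n + 1 : ℕ) : ℝ) ≠ 0 := by positivity
  rw [primeRecip, primeLogRecip, primesLE_succ_sum, primesLE_succ_sum, ← primeRecip,
    ← primeLogRecip]
  split_ifs
  · field_simp
    ring
  · field_simp
    ring

/-- Mertens' second theorem, up to a bounded error. -/
lemma primeRecip_bounds : ∃ C : ℝ, ∀ n : ℕ, 2 ≤ n →
    |primeRecip n - Real.log (Real.log n)| ≤ C := by
  obtain ⟨C₁, hC₁⟩ := primeLogRecip_ge
  have hl2 : 0 < Real.log 2 := Real.log_pos (by norm_num)
  have hl4 : 0 < Real.log 4 := Real.log_pos (by norm_num)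
  set C := |C₁| + 1 + Real.log 4 with hC
  have hC0 : 0 ≤ C := by positivity
  have hA : ∀ n : ℕ, 1 ≤ n → primeLogRecip n ≤ Real.log n + C := fun n hn => by
    have := primeLogRecip_le n hn
    have := abs_nonneg C₁
    linarith
  have hB : ∀ n : ℕ, 1 ≤ n → Real.log ((n + 1 : ℕ) : ℝ) - C ≤ primeLogRecip n := fun n hn => by
    have h1 := hC₁ n hn
    have h2 := le_abs_self C₁
    have hn0 : (1 : ℝ) ≤ n := by exact_mod_cast hn
    have h3 : Real.log ((n + 1 : ℕ) : ℝ) ≤ Real.log n + 1 := by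
      have h4 : Real.log ((n + 1 : ℕ) : ℝ) - Real.log n ≤ 1 := by
        rw [← Real.log_div (by positivity) (by positivity)]
        have : (((n + 1 : ℕ) : ℝ) / n) ≤ 1 + 1 := by
          rw [div_le_iff₀ (by linarith)]; push_cast; linarith
        have h5 := Real.log_le_sub_one_of_pos (x := ((n + 1 : ℕ) : ℝ) / n) (by positivity)
        linarith
      linarith
    linarith
  have hlog : ∀ n : ℕ, 2 ≤ n → Real.log 2 ≤ Real.log n := fun n hn =>
    Real.log_le_log (by norm_num) (by exact_mod_cast hn)
  have key : ∀ n : ℕ, 2 ≤ n →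
      (primeRecip n - primeLogRecip n / Real.log n) - (primeRecip 2 - primeLogRecip 2 / Real.log 2) ≤
        (Real.log (Real.log n) - C / Real.log n) - (Real.log (Real.log 2) - C / Real.log 2) ∧
      (Real.log (Real.log n) + C / Real.log n) - (Real.log (Real.log 2) + C / Real.log 2) ≤
      (primeRecip n - primeLogRecip n / Real.log n) -
        (primeRecip 2 - primeLogRecip 2 / Real.log 2) := by
    intro n hn
    induction n, hn using Nat.le_induction with
    | base => norm_num
    | succ n hn ih =>
      rw [primeRecip_sub_succ n hn]
      set a := Real.log n with ha
      set b := Real.log ((n + 1 : ℕ) : ℝ) with hb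
      have ha0 : 0 < a := hl2.trans_le (hlog n hn)
      have hab : a ≤ b := Real.log_le_log (by positivity) (by push_cast; linarith)
      have hb0 : 0 < b := ha0.trans_le hab
      have hd : 0 ≤ 1 / a - 1 / b := by
        rw [sub_nonneg]; exact one_div_le_one_div_of_le ha0 hab
      have u1 : primeLogRecip n * (1 / a - 1 / b) ≤ (a + C) * (1 / a - 1 / b) :=
        mul_le_mul_of_nonneg_right (hA n (by omega)) hd
      have u2 : (b - C) * (1 / a - 1 / b) ≤ primeLogRecip n * (1 / a - 1 / b) :=
        mul_le_mul_of_nonneg_right (hB n (by omega)) hd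
      have e1 : (a + C) * (1 / a - 1 / b) = 1 - a / b + C / a - C / b := by field_simp; ring
      have e2 : (b - C) * (1 / a - 1 / b) = b / a - 1 - C / a + C / b := by field_simp; ring
      have l1 : 1 - a / b ≤ Real.log b - Real.log a := by
        have := Real.log_le_sub_one_of_pos (x := a / b) (by positivity)
        rw [Real.log_div ha0.ne' hb0.ne'] at this
        linarith
      have l2 : Real.log b - Real.log a ≤ b / a - 1 := by
        have := Real.log_le_sub_one_of_pos (x := b / a) (by positivity)
        rw [Real.log_div hb0.ne' ha0.ne'] at this
        linarith
      constructor
      · linarith [ih.1]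
      · linarith [ih.2]
  set D := |primeRecip 2 - primeLogRecip 2 / Real.log 2| + |Real.log (Real.log 2)| +
    C / Real.log 2 with hD
  refine ⟨D + (1 + C / Real.log 2) + C / Real.log 2, fun n hn => ?_⟩
  obtain ⟨k1, k2⟩ := key n hn
  have hln := hlog n hn
  have hln0 : 0 < Real.log (n : ℝ) := hl2.trans_le hln
  have c1 : 0 ≤ C / Real.log n := by positivity
  have c2 : C / Real.log n ≤ C / Real.log 2 := by gcongr
  have c3 : primeLogRecip n / Real.log n ≤ 1 + C / Real.log n := by
    rw [div_le_iff₀ hln0, add_mul, div_mul_cancel₀ _ hln0.ne']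
    linarith [hA n (by omega)]
  have c4 : 0 ≤ primeLogRecip n / Real.log n :=
    div_nonneg (Finset.sum_nonneg fun p _ =>
      div_nonneg (Real.log_natCast_nonneg p) (by positivity)) hln0.le
  have a1 := abs_le.1 (le_refl |primeRecip 2 - primeLogRecip 2 / Real.log 2|)
  have a2 := abs_le.1 (le_refl |Real.log (Real.log 2)|)
  rw [abs_le]
  constructor <;> linarith [a1.1, a1.2, a2.1, a2.2]

lemma sum_recip_le_of_ratio (l : ℕ) (hl : 2 ≤ l) (S : Finset ℕ)
    (hS : ∀ p ∈ S, p.Prime ∧ l < p) (hr : ∀ p ∈ S, ∀ p' ∈ S, p' ≤ 16 * p) :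
    ∑ p ∈ S, (1 : ℝ) / p ≤ 16 * Real.log 4 / Real.log l := by
  have hl0 : 0 < Real.log l := Real.log_pos (by exact_mod_cast hl)
  have h4 : 0 < Real.log 4 := Real.log_pos (by norm_num)
  rcases S.eq_empty_or_nonempty with rfl | hne
  · simp; positivity
  set x := S.min' hne with hx
  have hxS : x ∈ S := S.min'_mem hne
  have hx0 : (0 : ℝ) < x := by exact_mod_cast (hS x hxS).1.pos
  have hsub : S ⊆ Nat.primesLE (16 * x) := fun p hp =>
    Nat.mem_primesLE.2 ⟨hr x hxS p hp, (hS p hp).1⟩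
  calc ∑ p ∈ S, (1 : ℝ) / p ≤ ∑ p ∈ S, Real.log p / (x * Real.log l) := by
        refine Finset.sum_le_sum fun p hp => ?_
        have hxp : (x : ℝ) ≤ p := by exact_mod_cast S.min'_le p hp
        have hlp : Real.log l ≤ Real.log p := by
          apply Real.log_le_log
          · exact_mod_cast (by omega : 0 < l)
          · exact_mod_cast (hS p hp).2.le
        rw [div_le_div_iff₀ (by linarith) (by positivity), one_mul, mul_comm]
        exact mul_le_mul hlp hxp hx0.le (hl0.le.trans hlp)
    _ = (∑ p ∈ S, Real.log p) / (x * Real.log l) := by rw [Finset.sum_div]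
    _ ≤ Chebyshev.theta ((16 * x : ℕ) : ℝ) / (x * Real.log l) := by
        gcongr
        rw [Chebyshev.theta_eq_sum_primesLE_log]
        exact Finset.sum_le_sum_of_subset_of_nonneg hsub fun p _ _ => Real.log_natCast_nonneg p
    _ ≤ (Real.log 4 * ((16 * x : ℕ) : ℝ)) / (x * Real.log l) := by
        gcongr
        exact Chebyshev.theta_le_log4_mul_x (by positivity)
    _ = _ := by push_cast; field_simp

lemma sum_recip_ge_of_window (x : ℝ) (hx : 64 ^ 4 ≤ x) (S : Finset ℕ)
    (hS : ∀ p : ℕ, p.Prime → x < p → (p : ℝ) ≤ 16 * x → p ∈ S) :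
    1 / 8 / Real.log x ≤ ∑ p ∈ S, (1 : ℝ) / p := by
  obtain ⟨t, ht, rfl⟩ : ∃ t : ℝ, 64 ≤ t ∧ x = t ^ 4 := by
    refine ⟨x ^ (1 / 4 : ℝ), ?_, ?_⟩
    · have : ((64 : ℝ) ^ 4) ^ (1 / 4 : ℝ) ≤ x ^ (1 / 4 : ℝ) :=
        Real.rpow_le_rpow (by positivity) hx (by norm_num)
      rwa [← Real.rpow_natCast, ← Real.rpow_mul (by norm_num), show ((4 : ℕ) : ℝ) * (1 / 4) = 1 by
        norm_num, Real.rpow_one] at this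
    · rw [← Real.rpow_natCast, ← Real.rpow_mul (by linarith [show (0:ℝ) ≤ 64 ^ 4 by positivity])]
      norm_num
  have ht0 : 0 < t := by linarith
  set x := t ^ 4 with hxt
  have hx0 : 0 < x := by positivity
  have hx1 : 64 ≤ x := by nlinarith
  have hlx : 0 < Real.log x := Real.log_pos (by linarith)
  have hl16 : Real.log (16 * x) ≤ 2 * Real.log x := by
    rw [Real.log_mul (by norm_num) hx0.ne']
    have : Real.log 16 ≤ Real.log x := Real.log_le_log (by norm_num) (by linarith)
    linarith
  set T := (Nat.primesLE ⌊16 * x⌋₊).filter (fun p : ℕ => x < p) with hT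
  have hTS : T ⊆ S := by
    intro p hp
    rw [hT, Finset.mem_filter, Nat.mem_primesLE, Nat.le_floor_iff (by positivity)] at hp
    exact hS p hp.1.2 hp.2 hp.1.1
  have hθ : Chebyshev.theta (16 * x) - Chebyshev.theta x ≤ ∑ p ∈ T, Real.log p := by
    rw [Chebyshev.theta_eq_sum_primesLE, Chebyshev.theta_eq_sum_primesLE, sub_le_iff_le_add]
    rw [hT, ← Finset.sum_filter_add_sum_filter_not (Nat.primesLE ⌊16 * x⌋₊) (fun p : ℕ => x < p)]
    gcongr
    intro p hp
    rw [Finset.mem_filter, Nat.mem_primesLE, not_lt] at hp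
    rw [Nat.mem_primesLE, Nat.le_floor_iff hx0.le]
    exact ⟨hp.2, hp.1.2⟩
  have h1 := Chebyshev.theta_ge' (x := 16 * x) (by linarith)
  have h2 := Chebyshev.theta_le_log4_mul_x hx0.le
  have hsq : √(16 * x) = 4 * t ^ 2 := by
    rw [show 16 * x = (4 * t ^ 2) ^ 2 by rw [hxt]; ring]
    exact Real.sqrt_sq (by positivity)
  have hlog1 : Real.log (16 * x) ≤ 8 * t := by
    rw [show 16 * x = (2 * t) ^ 4 by rw [hxt]; ring, Real.log_pow]
    have := Real.log_le_sub_one_of_pos (x := 2 * t) (by positivity)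
    push_cast; linarith
  have hlog2 : Real.log (16 * x + 2) ≤ 12 * t := by
    have h3 : Real.log (16 * x + 2) ≤ Real.log ((3 * t) ^ 4) := by
      apply Real.log_le_log (by positivity)
      rw [mul_pow, ← hxt]; linarith
    rw [Real.log_pow] at h3
    have := Real.log_le_sub_one_of_pos (x := 3 * t) (by positivity)
    push_cast at h3; linarith
  have hl4 : Real.log 4 = 2 * Real.log 2 := by
    rw [show (4 : ℝ) = 2 ^ 2 by norm_num, Real.log_pow]; norm_num
  have hmain : 4 * x ≤ ∑ p ∈ T, Real.log p := by
    have e1 : 2 * √(16 * x) * Real.log (16 * x) ≤ x := by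
      rw [hsq]
      calc 2 * (4 * t ^ 2) * Real.log (16 * x) ≤ 2 * (4 * t ^ 2) * (8 * t) := by gcongr
        _ = 64 * t ^ 3 := by ring
        _ ≤ t * t ^ 3 := by gcongr
        _ = x := by rw [hxt]; ring
    have e2 : 12 * t ≤ x := by
      rw [hxt]
      nlinarith [pow_pos ht0 2, pow_pos ht0 3, pow_le_pow_left₀ (by norm_num) ht 3]
    have g := Real.log_two_gt_d9
    have g' := Real.log_two_lt_d9
    nlinarith
  have hfin : ∑ p ∈ T, Real.log p ≤ 16 * x * Real.log (16 * x) * ∑ p ∈ T, (1 : ℝ) / p := by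
    rw [Finset.mul_sum]
    refine Finset.sum_le_sum fun p hp => ?_
    rw [hT, Finset.mem_filter, Nat.mem_primesLE, Nat.le_floor_iff (by positivity)] at hp
    have hp0 : (0 : ℝ) < p := by linarith [hp.2]
    have : Real.log p ≤ Real.log (16 * x) := Real.log_le_log hp0 hp.1.1
    have hlp : 0 ≤ Real.log p := Real.log_natCast_nonneg p
    rw [mul_one_div, le_div_iff₀ hp0, mul_comm]
    exact mul_le_mul hp.1.1 this hlp (by positivity)
  have hTT : ∑ p ∈ T, (1 : ℝ) / p ≤ ∑ p ∈ S, (1 : ℝ) / p :=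
    Finset.sum_le_sum_of_subset_of_nonneg hTS fun p _ _ => by positivity
  refine le_trans ?_ hTT
  have hs0 : 0 ≤ ∑ p ∈ T, (1 : ℝ) / p := Finset.sum_nonneg fun p _ => by positivity
  have h6 : 4 * x ≤ 16 * x * (2 * Real.log x) * ∑ p ∈ T, (1 : ℝ) / p :=
    hmain.trans (hfin.trans (by gcongr))
  rw [div_le_iff₀ hlx]
  nlinarith

/-- The primes in `(l h, l (h + 1)]`. -/
def block (l : ℕ → ℕ) (h : ℕ) : Finset ℕ := (Nat.primesLE (l (h + 1))).filter (fun p => l h < p)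

lemma mem_block {l : ℕ → ℕ} {h p : ℕ} :
    p ∈ block l h ↔ p.Prime ∧ l h < p ∧ p ≤ l (h + 1) := by
  rw [block, Finset.mem_filter, Nat.mem_primesLE]; tauto

lemma sum_block {l : ℕ → ℕ} {h : ℕ} (hl : l h ≤ l (h + 1)) :
    ∑ p ∈ block l h, (1 : ℝ) / p = primeRecip (l (h + 1)) - primeRecip (l h) := by
  rw [primeRecip, primeRecip, eq_sub_iff_add_eq, block,
    ← Finset.sum_filter_add_sum_filter_not (Nat.primesLE (l (h + 1))) (fun p => l h < p)]
  congr 1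
  apply Finset.sum_congr _ fun _ _ => rfl
  ext p
  rw [Finset.mem_filter, Nat.mem_primesLE, Nat.mem_primesLE]
  constructor
  · rintro ⟨h1, h2⟩; exact ⟨⟨by omega, h2⟩, by omega⟩
  · rintro ⟨h1, h2⟩; exact ⟨by omega, h1.2⟩

lemma primeRecip_mono : Monotone primeRecip := by
  intro a b hab
  refine Finset.sum_le_sum_of_subset_of_nonneg ?_ fun p _ _ => by positivity
  intro p hp
  rw [Nat.mem_primesLE] at *
  exact ⟨hp.1.trans hab, hp.2⟩

lemma exists_primeRecip_ge (y : ℝ) : ∃ n, y ≤ primeRecip n := by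
  obtain ⟨C, hC⟩ := primeRecip_bounds
  have ht : Tendsto (fun n : ℕ => Real.log (Real.log (n : ℝ))) atTop atTop :=
    Real.tendsto_log_atTop.comp (Real.tendsto_log_atTop.comp tendsto_natCast_atTop_atTop)
  obtain ⟨n, h1, h2⟩ := ((ht.eventually_ge_atTop (y + C)).and (eventually_ge_atTop 2)).exists
  exact ⟨n, by have := (abs_le.1 (hC n h2)).1; linarith⟩

lemma primeRecip_sub_le {a b : ℕ} (ha : 0 < a) (hab : a ≤ b) :
    primeRecip b - primeRecip a ≤ ((b : ℝ) - a) / a := by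
  induction b, hab using Nat.le_induction with
  | base => simp
  | succ b hb ih =>
    have ha0 : (0 : ℝ) < a := by exact_mod_cast ha
    have hb0 : (a : ℝ) ≤ b := by exact_mod_cast hb
    have h1 : primeRecip (b + 1) ≤ primeRecip b + 1 / a := by
      rw [primeRecip, primesLE_succ_sum, ← primeRecip]
      gcongr
      split_ifs
      · push_cast
        gcongr
        linarith
      · positivity
    have h2 : (((b + 1 : ℕ) : ℝ) - a) / a = ((b : ℝ) - a) / a + 1 / a := by
      push_cast; field_simp; ring
    linarith

/-- The endpoints of consecutive blocks of primes, each of harmonic mass about `log 2`. -/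
noncomputable def blockEnd : ℕ → ℕ
  | 0 => 64
  | h + 1 => sInf {n | primeRecip (blockEnd h) + Real.log 2 ≤ primeRecip n}

lemma blockEnd_succ_ge (h : ℕ) :
    primeRecip (blockEnd h) + Real.log 2 ≤ primeRecip (blockEnd (h + 1)) := by
  rw [blockEnd]
  exact Nat.sInf_mem (s := {n | primeRecip (blockEnd h) + Real.log 2 ≤ primeRecip n})
    (exists_primeRecip_ge _)

lemma blockEnd_lt_succ (h : ℕ) : blockEnd h < blockEnd (h + 1) := by
  by_contra hc
  have h1 := primeRecip_mono (not_lt.1 hc)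
  have h2 := blockEnd_succ_ge h
  have := Real.log_two_gt_d9
  linarith

lemma blockEnd_strictMono : StrictMono blockEnd := strictMono_nat_of_lt_succ blockEnd_lt_succ

lemma blockEnd_pos (h : ℕ) : 64 ≤ blockEnd h := by
  have := blockEnd_strictMono.monotone (Nat.zero_le h)
  rwa [show blockEnd 0 = 64 by rw [blockEnd]] at this

lemma blockEnd_succ_lt (h : ℕ) :
    primeRecip (blockEnd (h + 1)) ≤
      primeRecip (blockEnd h) + Real.log 2 + 1 / blockEnd (h + 1) := by
  set b := blockEnd (h + 1) with hb
  have h64 : 64 ≤ b := blockEnd_pos _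
  have hlt : b - 1 < b := by omega
  have hnot : ¬ (primeRecip (blockEnd h) + Real.log 2 ≤ primeRecip (b - 1)) := by
    intro hc
    have : b ≤ b - 1 := by
      conv_lhs => rw [hb, blockEnd]
      exact Nat.sInf_le hc
    omega
  obtain ⟨c, hc⟩ : ∃ c, b = c + 1 := ⟨b - 1, by omega⟩
  rw [hc] at hnot ⊢
  rw [Nat.add_sub_cancel] at hnot
  have h1 : primeRecip (c + 1) ≤ primeRecip c + 1 / ((c + 1 : ℕ) : ℝ) := by
    rw [primeRecip, primesLE_succ_sum, ← primeRecip]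
    gcongr
    split_ifs
    · exact le_rfl
    · positivity
  linarith

lemma blockEnd_growth (h : ℕ) : (64 : ℝ) * (3 / 2) ^ h ≤ blockEnd h := by
  induction h with
  | zero => simp [blockEnd]
  | succ h ih =>
    have h1 := blockEnd_succ_ge h
    have h0 : (0 : ℝ) < blockEnd h := by
      have := blockEnd_pos h
      exact_mod_cast (by omega : 0 < blockEnd h)
    have h2 := primeRecip_sub_le (a := blockEnd h) (by have := blockEnd_pos h; omega)
      (blockEnd_lt_succ h).le
    have h3 : (1 : ℝ) / 2 ≤ ((blockEnd (h + 1) : ℝ) - blockEnd h) / blockEnd h := by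
      have := Real.log_two_gt_d9
      linarith
    rw [le_div_iff₀ h0] at h3
    rw [pow_succ]
    linarith

lemma sum_inv_blockEnd (n : ℕ) : ∑ h ∈ Finset.range n, 1 / (blockEnd h : ℝ) ≤ 3 / 64 := by
  have h1 : ∀ h, 1 / (blockEnd h : ℝ) ≤ 1 / 64 * (2 / 3) ^ h := fun h => by
    have h0 : (0 : ℝ) < 64 * (3 / 2) ^ h := by positivity
    refine (one_div_le_one_div_of_le h0 (blockEnd_growth h)).trans (le_of_eq ?_)
    rw [show (2 / 3 : ℝ) = (3 / 2)⁻¹ by norm_num, inv_pow]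
    field_simp
  refine (Finset.sum_le_sum fun h _ => h1 h).trans ?_
  rw [← Finset.mul_sum]
  have := geom_sum_eq (show (2 / 3 : ℝ) ≠ 1 by norm_num) n
  rw [this, show (2 / 3 : ℝ) - 1 = -(1 / 3) by norm_num, div_neg]
  have : (0 : ℝ) ≤ (2 / 3) ^ n := by positivity
  linarith

lemma primeRecip_blockEnd_le (h : ℕ) :
    primeRecip (blockEnd h) ≤ primeRecip 64 + h * Real.log 2 +
      ∑ i ∈ Finset.range (h + 1), 1 / (blockEnd i : ℝ) := by
  induction h with
  | zero => simp [blockEnd]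
  | succ h ih =>
    have := blockEnd_succ_lt h
    rw [Finset.sum_range_succ]
    push_cast
    linarith

lemma primeRecip_blockEnd_ge (h : ℕ) :
    primeRecip 64 + h * Real.log 2 ≤ primeRecip (blockEnd h) := by
  induction h with
  | zero => simp [blockEnd]
  | succ h ih =>
    have := blockEnd_succ_ge h
    push_cast
    linarith

lemma log_blockEnd : ∃ c C : ℝ, 0 < c ∧ 0 < C ∧ ∀ h,
    c * 2 ^ h ≤ Real.log (blockEnd h) ∧ Real.log (blockEnd h) ≤ C * 2 ^ h := by
  obtain ⟨K, hK⟩ := primeRecip_bounds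
  refine ⟨Real.exp (primeRecip 64 - K), Real.exp (primeRecip 64 + 1 + K), Real.exp_pos _,
    Real.exp_pos _, fun h => ?_⟩
  have h64 := blockEnd_pos h
  have h1 := abs_le.1 (hK (blockEnd h) (by omega))
  have hl : 0 < Real.log (blockEnd h) := Real.log_pos (by exact_mod_cast (by omega))
  have h2 : (2 : ℝ) ^ h = Real.exp (h * Real.log 2) := by
    rw [mul_comm, Real.exp_mul, Real.exp_log (by norm_num), Real.rpow_natCast]
  rw [h2, ← Real.exp_add, ← Real.exp_add]
  constructor
  · rw [← Real.le_log_iff_exp_le hl]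
    have := primeRecip_blockEnd_ge h
    linarith
  · rw [← Real.log_le_iff_le_exp hl]
    have := primeRecip_blockEnd_le h
    have := sum_inv_blockEnd (h + 1)
    linarith

lemma sum_block_ge (h : ℕ) : Real.log 2 ≤ ∑ p ∈ block blockEnd h, (1 : ℝ) / p := by
  rw [sum_block (blockEnd_lt_succ h).le]
  linarith [blockEnd_succ_ge h]

lemma sum_block_le (h : ℕ) : ∑ p ∈ block blockEnd h, (1 : ℝ) / p ≤ 1 := by
  rw [sum_block (blockEnd_lt_succ h).le]
  have h1 := blockEnd_succ_lt h
  have h2 : 1 / (blockEnd (h + 1) : ℝ) ≤ 1 / 64 :=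
    one_div_le_one_div_of_le (by norm_num) (by exact_mod_cast blockEnd_pos _)
  have := Real.log_two_lt_d9
  linarith

section Cyclic

variable {k : ℕ}

/-- The number of coordinates of `f` with value below `n`. -/
def countBelow (f : Fin k → ZMod k) (n : ℕ) : ℕ :=
  (Finset.univ.filter (fun i => (f i).val < n)).card

/-- The cyclic weight governing second moments. -/
noncomputable def cycWeight (f : Fin k → ZMod k) : ℝ :=
  ∑ n ∈ Finset.range k, (2 : ℝ) ^ countBelow f (n + 1) / 2 ^ (n + 1)

lemma cycWeight_pos [NeZero k] (f : Fin k → ZMod k) : 0 < cycWeight f :=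
  Finset.sum_pos (fun _ _ => by positivity) ⟨0, Finset.mem_range.2 (NeZero.pos k)⟩

/-- The number of coordinates of `f` equal to `m`. -/
def countEq (f : Fin k → ZMod k) (m : ℕ) : ℕ :=
  (Finset.univ.filter (fun i => f i = (m : ZMod k))).card

lemma countBelow_eq_sum [NeZero k] (f : Fin k → ZMod k) (n : ℕ) (hn : n ≤ k) :
    countBelow f n = ∑ m ∈ Finset.range n, countEq f m := by
  induction n with
  | zero => simp [countBelow]
  | succ n ih =>
    rw [Finset.sum_range_succ, ← ih (by omega), countBelow, countBelow, countEq,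
      ← Finset.card_union_of_disjoint]
    · congr 1
      ext i
      simp only [Finset.mem_filter, Finset.mem_univ, true_and, Finset.mem_union]
      have : f i = (n : ZMod k) ↔ (f i).val = n := by
        constructor
        · intro h; rw [h, ZMod.val_natCast_of_lt (by omega)]
        · intro h; rw [← h, ZMod.natCast_zmod_val]
      rw [this]; omega
    · rw [Finset.disjoint_filter]
      intro i _ h1 h2
      rw [h2, ZMod.val_natCast_of_lt (by omega)] at h1
      omega

lemma sum_range_shift (b : ℕ → ℝ) (hb : ∀ n, b (n + k) = b n) (s : ℕ) :
    ∑ n ∈ Finset.range k, b (n + s) = ∑ n ∈ Finset.range k, b n := by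
  induction s with
  | zero => simp
  | succ s ih =>
    rw [← ih]
    have h1 := Finset.sum_range_succ (fun n => b (n + s)) k
    have h2 := Finset.sum_range_succ' (fun n => b (n + s)) k
    rw [h1] at h2
    have h3 : b (k + s) = b (0 + s) := by rw [add_comm, hb, zero_add]
    rw [h3] at h2
    have h4 := add_right_cancel h2
    rw [h4]
    exact Finset.sum_congr rfl fun n _ => by rw [add_right_comm, add_assoc]

lemma countEq_add (f : Fin k → ZMod k) (n : ℕ) : countEq f (n + k) = countEq f n := by
  simp [countEq]

/-- The `k`-periodic sequence whose ratios give the cyclic weights of all shifts of `f`. -/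
noncomputable def cycSeq (f : Fin k → ZMod k) (n : ℕ) : ℝ :=
  (2 : ℝ) ^ (∑ m ∈ Finset.range n, countEq f m) / 2 ^ n

lemma cycSeq_add [NeZero k] (f : Fin k → ZMod k) (n : ℕ) : cycSeq f (n + k) = cycSeq f n := by
  have h0 : ∑ m ∈ Finset.range k, countEq f m = k := by
    rw [← countBelow_eq_sum f k le_rfl, countBelow, Finset.filter_true_of_mem]
    · simp
    · intro i _; exact ZMod.val_lt _
  have h1 : ∑ m ∈ Finset.range (n + k), countEq f m = (∑ m ∈ Finset.range n, countEq f m) + k := by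
    rw [add_comm n k, Finset.sum_range_add, h0, add_comm]
    congr 1
    exact Finset.sum_congr rfl fun m _ => by rw [add_comm, countEq_add]
  rw [cycSeq, cycSeq, h1, pow_add, pow_add, mul_div_mul_right _ _ (by positivity)]

lemma cycSeq_pos (f : Fin k → ZMod k) (n : ℕ) : 0 < cycSeq f n := by
  unfold cycSeq; positivity

lemma cycWeight_shift [NeZero k] (f : Fin k → ZMod k) (s : ℕ) :
    cycWeight (fun i => f i - (s : ZMod k)) =
      (∑ n ∈ Finset.range k, cycSeq f n) / cycSeq f s := by
  rw [← sum_range_shift (cycSeq f) (cycSeq_add f) (s + 1), Finset.sum_div, cycWeight]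
  refine Finset.sum_congr rfl fun n hn => ?_
  rw [Finset.mem_range] at hn
  have h1 : ∀ m, countEq (fun i => f i - (s : ZMod k)) m = countEq f (s + m) := fun m => by
    unfold countEq
    congr 1
    ext i
    simp only [Finset.mem_filter, Finset.mem_univ, true_and]
    rw [sub_eq_iff_eq_add]; push_cast; rw [add_comm]
  rw [countBelow_eq_sum _ _ (by omega), Finset.sum_congr rfl fun m _ => h1 m]
  have h2 := Finset.sum_range_add (fun m => countEq f m) s (n + 1)
  rw [cycSeq, cycSeq, show n + (s + 1) = s + (n + 1) by ring, h2, pow_add, pow_add _ s]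
  field_simp
  ring

lemma sum_inv_cycWeight [NeZero k] :
    (k : ℝ) * ∑ f : Fin k → ZMod k, 1 / cycWeight f = (k : ℝ) ^ k := by
  have h1 : ∀ s : ℕ, ∑ f : Fin k → ZMod k, 1 / cycWeight (fun i => f i - (s : ZMod k)) =
      ∑ f : Fin k → ZMod k, 1 / cycWeight f := fun s =>
    (Equiv.subRight (fun _ : Fin k => (s : ZMod k))).sum_comp (fun f => 1 / cycWeight f)
  have h2 : ∀ f : Fin k → ZMod k,
      ∑ s ∈ Finset.range k, 1 / cycWeight (fun i => f i - (s : ZMod k)) = 1 := fun f => by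
    have hp : 0 < ∑ n ∈ Finset.range k, cycSeq f n :=
      Finset.sum_pos (fun n _ => cycSeq_pos f n) ⟨0, Finset.mem_range.2 (NeZero.pos k)⟩
    simp_rw [cycWeight_shift, one_div_div]
    rw [← Finset.sum_div, div_self hp.ne']
  calc (k : ℝ) * ∑ f : Fin k → ZMod k, 1 / cycWeight f
      = ∑ s ∈ Finset.range k, ∑ f : Fin k → ZMod k, 1 / cycWeight (fun i => f i - (s : ZMod k)) := by
        simp_rw [h1]; simp
    _ = (k : ℝ) ^ k := by
        rw [Finset.sum_comm]; simp_rw [h2]; simp [ZMod.card]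

lemma cycWeight_update_le (f : Fin k → ZMod k) (i : Fin k) (c : ZMod k) :
    cycWeight (Function.update f i c) ≤ 2 * cycWeight f := by
  rw [cycWeight, cycWeight, Finset.mul_sum]
  refine Finset.sum_le_sum fun n _ => ?_
  have : countBelow (Function.update f i c) (n + 1) ≤ countBelow f (n + 1) + 1 := by
    rw [countBelow, countBelow]
    refine le_trans (Finset.card_le_card ?_) (Finset.card_insert_le i _)
    intro j hj
    by_cases hji : j = i
    · simp [hji]
    · simp [hji] at hj ⊢; exact hj
  rw [← mul_div_assoc, ← pow_succ']
  gcongr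
  norm_num

lemma sum_fixed_coord_le [NeZero k] (i : Fin k) (h : ZMod k) :
    (k : ℝ) * ∑ f : Fin k → ZMod k with f i = h, 1 / cycWeight f ≤
      2 * ∑ f : Fin k → ZMod k, 1 / cycWeight f := by
  have hm : ∀ f ∈ (Finset.univ : Finset (Fin k → ZMod k)), Function.update f i h ∈
      Finset.univ.filter (fun f : Fin k → ZMod k => f i = h) := by
    intro f _; simp
  rw [← Finset.sum_fiberwise_of_maps_to hm, Finset.mul_sum, Finset.mul_sum]
  refine Finset.sum_le_sum fun f hf => ?_
  rw [Finset.mem_filter] at hf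
  set T := Finset.univ.image (fun c : ZMod k => Function.update f i c) with hT
  have hcard : T.card = k := by
    rw [hT, Finset.card_image_of_injective _ (Function.update_injective f i), Finset.card_univ,
      ZMod.card]
  have hTsub : T ⊆ Finset.univ.filter (fun f' : Fin k → ZMod k => Function.update f' i h = f) := by
    intro g hg
    rw [hT, Finset.mem_image] at hg
    obtain ⟨c, _, rfl⟩ := hg
    rw [Finset.mem_filter]
    refine ⟨Finset.mem_univ _, ?_⟩
    rw [Function.update_idem, ← hf.2, Function.update_eq_self]
  have h1 : (k : ℝ) * (1 / (2 * cycWeight f)) ≤ ∑ g ∈ T, 1 / cycWeight g := by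
    have := Finset.card_nsmul_le_sum T (fun g => 1 / cycWeight g) (1 / (2 * cycWeight f)) (by
      intro g hg
      rw [hT, Finset.mem_image] at hg
      obtain ⟨c, _, rfl⟩ := hg
      exact one_div_le_one_div_of_le (cycWeight_pos _) (cycWeight_update_le f i c))
    rwa [hcard, nsmul_eq_mul] at this
  have h2 := Finset.sum_le_sum_of_subset_of_nonneg (f := fun g => 1 / cycWeight g) hTsub
    fun g _ _ => (one_div_pos.2 (cycWeight_pos g)).le
  have h3 : (k : ℝ) * (1 / cycWeight f) = 2 * ((k : ℝ) * (1 / (2 * cycWeight f))) := by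
    have := cycWeight_pos f
    field_simp
  linarith

lemma sum_good_cycWeight [NeZero k] (w : ZMod k → ℝ) (hw : ∀ h, 0 ≤ w h)
    (hsum : ∑ h, w h ≤ 1 / 4) :
    (k : ℝ) ^ k ≤ 2 * k * ∑ f : Fin k → ZMod k with ∑ i, w (f i) ≤ 1, 1 / cycWeight f := by
  have hk : (0 : ℝ) < k := by exact_mod_cast NeZero.pos k
  set A := ∑ f : Fin k → ZMod k, 1 / cycWeight f with hA
  have hA0 : 0 ≤ A := Finset.sum_nonneg fun f _ => (one_div_pos.2 (cycWeight_pos f)).le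
  have h1 : ∀ i : Fin k, ∑ f : Fin k → ZMod k, w (f i) * (1 / cycWeight f) ≤ A / (2 * k) := by
    intro i
    rw [← Finset.sum_fiberwise (s := Finset.univ) (g := fun f : Fin k → ZMod k => f i)]
    calc _ = ∑ h, w h * ∑ f : Fin k → ZMod k with f i = h, 1 / cycWeight f := by
          refine Finset.sum_congr rfl fun h _ => ?_
          rw [Finset.mul_sum]
          refine Finset.sum_congr rfl fun f hf => ?_
          rw [(Finset.mem_filter.1 hf).2]
      _ ≤ ∑ h, w h * (2 * A / k) := by
          refine Finset.sum_le_sum fun h _ => mul_le_mul_of_nonneg_left ?_ (hw h)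
          rw [le_div_iff₀ hk, mul_comm]
          exact sum_fixed_coord_le i h
      _ = (∑ h, w h) * (2 * A / k) := by rw [Finset.sum_mul]
      _ ≤ 1 / 4 * (2 * A / k) := by gcongr
      _ = A / (2 * k) := by field_simp; norm_num
  have h2 : ∑ f : Fin k → ZMod k, (∑ i, w (f i)) * (1 / cycWeight f) ≤ A / 2 := by
    simp_rw [Finset.sum_mul]
    rw [Finset.sum_comm]
    refine (Finset.sum_le_sum fun i _ => h1 i).trans (le_of_eq ?_)
    simp
    field_simp
  have h3 : ∑ f : Fin k → ZMod k with ¬ ∑ i, w (f i) ≤ 1, 1 / cycWeight f ≤ A / 2 := by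
    refine le_trans ?_ h2
    rw [← Finset.sum_filter_add_sum_filter_not Finset.univ
      (fun f : Fin k → ZMod k => ∑ i, w (f i) ≤ 1) (fun f => (∑ i, w (f i)) * (1 / cycWeight f))]
    refine le_add_of_nonneg_of_le (Finset.sum_nonneg fun f _ => ?_) (Finset.sum_le_sum fun f hf => ?_)
    · exact mul_nonneg (Finset.sum_nonneg fun i _ => hw _) (one_div_pos.2 (cycWeight_pos f)).le
    · have := (Finset.mem_filter.1 hf).2
      exact le_mul_of_one_le_left (one_div_pos.2 (cycWeight_pos f)).le (not_le.1 this).le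
  have h4 := Finset.sum_filter_add_sum_filter_not Finset.univ
      (fun f : Fin k → ZMod k => ∑ i, w (f i) ≤ 1) (fun f => 1 / cycWeight f)
  rw [← sum_inv_cycWeight (k := k), ← hA]
  nlinarith

end Cyclic

section Tuples

variable {k : ℕ}

/-- The reciprocal weight of a tuple. -/
noncomputable def tupWeight (p : Fin k → ℕ) : ℝ := ∏ i, (1 : ℝ) / p i

lemma tupWeight_nonneg (p : Fin k → ℕ) : 0 ≤ tupWeight p :=
  Finset.prod_nonneg fun _ _ => by positivity

lemma sum_tupWeight (D : Fin k → Finset ℕ) :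
    ∑ p ∈ Fintype.piFinset D, tupWeight p = ∏ i, ∑ x ∈ D i, (1 : ℝ) / x :=
  (Finset.prod_univ_sum D (fun _ x => (1 : ℝ) / x)).symm

lemma tupWeight_update (p : Fin k → ℕ) (i : Fin k) (x : ℕ) :
    tupWeight p * (1 / x) = tupWeight (Function.update p i x) * (1 / p i) := by
  have h1 := Finset.prod_update_of_mem (Finset.mem_univ i) (fun j => (1 : ℝ) / p j) (1 / (x : ℝ))
  have h2 : tupWeight (Function.update p i x) =
      ∏ j, Function.update (fun j => (1 : ℝ) / p j) i (1 / (x : ℝ)) j := by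
    refine Finset.prod_congr rfl fun j _ => ?_
    by_cases hj : j = i
    · subst hj; simp
    · simp [hj]
  have h3 : tupWeight p = 1 / p i * ∏ j ∈ Finset.univ \ {i}, (1 : ℝ) / p j := by
    rw [tupWeight, ← Finset.prod_sdiff (Finset.subset_univ {i}), Finset.prod_singleton, mul_comm]
  rw [h2, h1, h3]
  ring

lemma resample (D : Fin k → Finset ℕ) (i : Fin k) (φ : (Fin k → ℕ) → ℝ) :
    (∑ x ∈ D i, (1 : ℝ) / x) * ∑ p ∈ Fintype.piFinset D, tupWeight p * φ p =
      ∑ p ∈ Fintype.piFinset D, tupWeight p * ∑ x ∈ D i, 1 / x * φ (Function.update p i x) := by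
  rw [mul_comm, Finset.sum_mul_sum]
  simp_rw [Finset.mul_sum]
  rw [← Finset.sum_product', ← Finset.sum_product']
  have hmem : ∀ a ∈ Fintype.piFinset D ×ˢ D i,
      (Function.update a.1 i a.2, a.1 i) ∈ Fintype.piFinset D ×ˢ D i := by
    rintro ⟨p, x⟩ hp
    rw [Finset.mem_product, Fintype.mem_piFinset] at hp ⊢
    refine ⟨fun j => ?_, hp.1 i⟩
    by_cases hj : j = i
    · subst hj; simpa using hp.2
    · simpa [hj] using hp.1 j
  refine Finset.sum_bij' (fun a _ => (Function.update a.1 i a.2, a.1 i))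
    (fun a _ => (Function.update a.1 i a.2, a.1 i)) hmem hmem ?_ ?_ ?_
  · rintro ⟨p, x⟩ _; simp
  · rintro ⟨p, x⟩ _; simp
  · rintro ⟨p, x⟩ _
    simp only [Function.update_idem, Function.update_eq_self]
    have := tupWeight_update p i x
    linear_combination φ p * this

/-- The product of the entries of a tuple over a set of indices. -/
def subProd (p : Fin k → ℕ) (Y : Finset (Fin k)) : ℕ := ∏ i ∈ Y, p i

lemma subProd_update_mem (p : Fin k → ℕ) (Y : Finset (Fin k)) {i : Fin k} (hi : i ∈ Y) (x : ℕ) :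
    subProd (Function.update p i x) Y = x * subProd p (Y \ {i}) :=
  Finset.prod_update_of_mem hi p x

lemma subProd_update_notMem (p : Fin k → ℕ) (Y : Finset (Fin k)) {i : Fin k} (hi : i ∉ Y) (x : ℕ) :
    subProd (Function.update p i x) Y = subProd p Y :=
  Finset.prod_update_of_notMem hi p x

lemma subProd_pos {p : Fin k → ℕ} (hp : ∀ i, 0 < p i) (Y : Finset (Fin k)) : 0 < subProd p Y :=
  Finset.prod_pos fun i _ => hp i

lemma subProd_mul_compl (p : Fin k → ℕ) (Y : Finset (Fin k)) :
    subProd p Y * subProd p Yᶜ = ∏ i, p i := Finset.prod_mul_prod_compl Y p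

/-- The ratios attached to `Y` and `Z` differ by a factor at most `16`. -/
def CloseRatio (p : Fin k → ℕ) (Y Z : Finset (Fin k)) : Prop :=
  subProd p Y * subProd p Zᶜ ≤ 16 * (subProd p Z * subProd p Yᶜ) ∧
    subProd p Z * subProd p Yᶜ ≤ 16 * (subProd p Y * subProd p Zᶜ)

lemma closeRatio_comm (p : Fin k → ℕ) (Y Z : Finset (Fin k)) :
    CloseRatio p Y Z ↔ CloseRatio p Z Y := by
  unfold CloseRatio; exact and_comm

lemma closeRatio_ratio {p : Fin k → ℕ} (hp : ∀ i, 0 < p i) {Y Z : Finset (Fin k)} {i : Fin k}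
    (hY : i ∈ Y) (hZ : i ∉ Z) {x x' : ℕ} (hx : CloseRatio (Function.update p i x) Y Z)
    (hx' : CloseRatio (Function.update p i x') Y Z) : x ≤ 16 * x' := by
  have hYc : i ∉ Yᶜ := by simpa using hY
  have hZc : i ∈ Zᶜ := by simpa using hZ
  unfold CloseRatio at hx hx'
  rw [subProd_update_mem p Y hY, subProd_update_mem p Zᶜ hZc, subProd_update_notMem p Z hZ,
    subProd_update_notMem p Yᶜ hYc] at hx hx'
  have h1 := subProd_pos hp (Y \ {i})
  have h2 := subProd_pos hp (Zᶜ \ {i})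
  set a := subProd p (Y \ {i})
  set b := subProd p (Zᶜ \ {i})
  set M := subProd p Z * subProd p Yᶜ
  have h3 : (a * b) * (x * x) ≤ (a * b) * (16 * x' * (16 * x')) := by
    nlinarith [hx.1, hx'.2]
  have h4 := le_of_mul_le_mul_left h3 (Nat.mul_pos h1 h2)
  exact Nat.mul_self_le_mul_self_iff.1 h4

open Classical in
lemma sum_close_le (l : ℕ → ℕ) (f : Fin k → ℕ) (hl : ∀ h, 2 ≤ l h)
    (hge : ∀ h, Real.log 2 ≤ ∑ p ∈ block l h, (1 : ℝ) / p)
    (Y Z : Finset (Fin k)) (i : Fin k) (hi : ¬ (i ∈ Y ↔ i ∈ Z)) :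
    ∑ p ∈ Fintype.piFinset (fun i => block l (f i)) with CloseRatio p Y Z, tupWeight p ≤
      (∏ i, ∑ x ∈ block l (f i), (1 : ℝ) / x) *
        (16 * Real.log 4 / Real.log 2 / Real.log (l (f i))) := by
  set D : Fin k → Finset ℕ := fun i => block l (f i) with hD
  have hg := Real.log_two_gt_d9
  have hl2 : 0 < Real.log 2 := by linarith
  wlog hYZ : i ∈ Y ∧ i ∉ Z generalizing Y Z with H
  · simp_rw [closeRatio_comm _ Y Z]
    exact H Z Y (by tauto) (by tauto)
  have h1 := resample D i (fun p => if CloseRatio p Y Z then 1 else 0)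
  simp only [mul_ite, mul_one, mul_zero] at h1
  rw [← Finset.sum_filter] at h1
  have h2 : ∀ p ∈ Fintype.piFinset D, tupWeight p *
      ∑ x ∈ D i, (if CloseRatio (Function.update p i x) Y Z then 1 / (x : ℝ) else 0) ≤
      tupWeight p * (16 * Real.log 4 / Real.log (l (f i))) := by
    intro p hp
    refine mul_le_mul_of_nonneg_left ?_ (tupWeight_nonneg p)
    rw [Fintype.mem_piFinset] at hp
    rw [← Finset.sum_filter]
    refine sum_recip_le_of_ratio (l (f i)) (hl _) _ ?_ ?_
    · intro x hx
      have := mem_block.1 (Finset.mem_filter.1 hx).1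
      exact ⟨this.1, this.2.1⟩
    · intro x hx x' hx'
      exact closeRatio_ratio (fun j => (mem_block.1 (hp j)).1.pos) hYZ.1 hYZ.2
        (Finset.mem_filter.1 hx').2 (Finset.mem_filter.1 hx).2
  have h3 := Finset.sum_le_sum h2
  rw [← h1, ← Finset.sum_mul, sum_tupWeight] at h3
  have h4 : 0 ≤ ∑ p ∈ Fintype.piFinset D with CloseRatio p Y Z, tupWeight p :=
    Finset.sum_nonneg fun p _ => tupWeight_nonneg p
  have h5 := mul_le_mul_of_nonneg_right (hge (f i)) h4
  have h6 := h5.trans h3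
  rw [mul_comm, ← le_div_iff₀ hl2] at h6
  refine h6.trans (le_of_eq ?_)
  ring

end Tuples

section SecondMoment

variable {k : ℕ}

lemma card_agree_above_le (f : Fin k → ZMod k) (h : ℕ) (Y : Finset (Fin k)) :
    (Finset.univ.filter (fun Z : Finset (Fin k) => ∀ j, h < (f j).val → (j ∈ Y ↔ j ∈ Z))).card ≤
      2 ^ countBelow f (h + 1) := by
  set I := Finset.univ.filter (fun i => (f i).val < h + 1) with hI
  rw [countBelow, ← Finset.card_powerset]
  refine Finset.card_le_card_of_injOn (fun Z => Z ∩ I) ?_ ?_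
  · intro Z _
    simp only [Finset.coe_powerset, Set.mem_preimage, Set.mem_powerset_iff, Finset.coe_subset]
    exact Finset.inter_subset_right
  · intro Z hZ W hW hZW
    simp only [Finset.coe_filter, Finset.mem_univ, true_and, Set.mem_ofPred_eq] at hZ hW
    ext j
    by_cases hj : h < (f j).val
    · rw [← hZ j hj, ← hW j hj]
    · have hjI : j ∈ I := by rw [hI, Finset.mem_filter]; exact ⟨Finset.mem_univ _, by omega⟩
      have := Finset.ext_iff.1 hZW j
      simpa [hjI] using this

open Classical in
lemma sum_pairs_close_le [NeZero k] (f : Fin k → ZMod k) (l : ℕ → ℕ) (C : ℝ) (hC1 : 1 ≤ C)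
    (hl : ∀ h, 2 ≤ l h) (hge : ∀ h, Real.log 2 ≤ ∑ p ∈ block l h, (1 : ℝ) / p)
    (hC : ∀ h, 16 * Real.log 4 / Real.log 2 / Real.log (l h) ≤ C / 2 ^ h) :
    ∑ Y : Finset (Fin k), ∑ Z : Finset (Fin k),
      ∑ p ∈ Fintype.piFinset (fun i => block l (f i).val) with CloseRatio p Y Z, tupWeight p ≤
      (∏ i, ∑ x ∈ block l (f i).val, (1 : ℝ) / x) * (2 * C * 2 ^ k * cycWeight f) := by
  set S := ∏ i, ∑ x ∈ block l (f i).val, (1 : ℝ) / x with hS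
  have hS0 : 0 ≤ S := Finset.prod_nonneg fun i _ => Finset.sum_nonneg fun x _ => by positivity
  have key : ∀ Y Z : Finset (Fin k),
      ∑ p ∈ Fintype.piFinset (fun i => block l (f i).val) with CloseRatio p Y Z, tupWeight p ≤
      ∑ h ∈ Finset.range k, if (∀ j, h < (f j).val → (j ∈ Y ↔ j ∈ Z)) then S * C / 2 ^ h else 0 := by
    intro Y Z
    have hnn : ∀ h ∈ Finset.range k,
        0 ≤ if (∀ j, h < (f j).val → (j ∈ Y ↔ j ∈ Z)) then S * C / 2 ^ h else 0 := by
      intro h _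
      split_ifs
      · positivity
      · exact le_rfl
    by_cases hYZ : ∀ j, j ∈ Y ↔ j ∈ Z
    · refine le_trans ?_ (Finset.single_le_sum hnn (Finset.mem_range.2 (NeZero.pos k)))
      rw [if_pos fun j _ => hYZ j]
      calc _ ≤ ∑ p ∈ Fintype.piFinset (fun i => block l (f i).val), tupWeight p :=
            Finset.sum_le_sum_of_subset_of_nonneg (Finset.filter_subset _ _)
              fun p _ _ => tupWeight_nonneg p
        _ = S := sum_tupWeight _
        _ ≤ S * C / 2 ^ 0 := by rw [pow_zero, div_one]; exact le_mul_of_one_le_right hS0 hC1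
    · push Not at hYZ
      obtain ⟨j0, hj0⟩ := hYZ
      set T := Finset.univ.filter (fun j => ¬ (j ∈ Y ↔ j ∈ Z)) with hT
      have hTne : T.Nonempty := ⟨j0, by rw [hT, Finset.mem_filter]; exact ⟨Finset.mem_univ _, by tauto⟩⟩
      obtain ⟨i, hi, hmax⟩ := Finset.exists_max_image T (fun j => (f j).val) hTne
      refine le_trans ?_ (Finset.single_le_sum hnn (Finset.mem_range.2 (ZMod.val_lt (f i))))
      rw [if_pos]
      · refine (sum_close_le l (fun i => (f i).val) hl hge Y Z i (Finset.mem_filter.1 hi).2).trans ?_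
        rw [mul_div_assoc S]
        exact mul_le_mul_of_nonneg_left (hC _) hS0
      · intro j hj
        by_contra hc
        have := hmax j (by rw [hT, Finset.mem_filter]; exact ⟨Finset.mem_univ _, hc⟩)
        omega
  calc _ ≤ ∑ Y : Finset (Fin k), ∑ Z : Finset (Fin k), ∑ h ∈ Finset.range k,
        (if (∀ j, h < (f j).val → (j ∈ Y ↔ j ∈ Z)) then S * C / 2 ^ h else 0) :=
        Finset.sum_le_sum fun Y _ => Finset.sum_le_sum fun Z _ => key Y Z
    _ ≤ ∑ Y : Finset (Fin k), ∑ h ∈ Finset.range k, S * C / 2 ^ h * 2 ^ countBelow f (h + 1) := by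
        refine Finset.sum_le_sum fun Y _ => ?_
        rw [Finset.sum_comm]
        refine Finset.sum_le_sum fun h _ => ?_
        rw [← Finset.sum_filter, Finset.sum_const, nsmul_eq_mul, mul_comm]
        have := card_agree_above_le f h Y
        refine mul_le_mul_of_nonneg_left ?_ (by positivity)
        exact_mod_cast this
    _ = S * (2 * C * 2 ^ k * cycWeight f) := by
        rw [Finset.sum_const, Finset.card_univ, Fintype.card_finset, Fintype.card_fin, cycWeight,
          nsmul_eq_mul, Finset.mul_sum, Finset.mul_sum, Finset.mul_sum]
        refine Finset.sum_congr rfl fun h _ => ?_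
        push_cast
        field_simp
        ring

/-- The window condition on two extra primes making the divisors `subProd p Y * u` and
`subProd p Yᶜ * v` comparable. -/
def InWindow (p : Fin k → ℕ) (u v : ℕ) (Y : Finset (Fin k)) : Prop :=
  subProd p Y * u < subProd p Yᶜ * v ∧ subProd p Yᶜ * v ≤ 16 * (subProd p Y * u)

lemma InWindow.closeRatio {p : Fin k → ℕ} {u v : ℕ} {Y Z : Finset (Fin k)} (hu : 0 < u)
    (hv : 0 < v) (hY : InWindow p u v Y) (hZ : InWindow p u v Z) : CloseRatio p Y Z := by
  have huv : 0 < u * v := Nat.mul_pos hu hv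
  unfold InWindow at hY hZ
  constructor
  · have := Nat.mul_le_mul hY.1.le hZ.2
    refine le_of_mul_le_mul_right ?_ huv
    nlinarith
  · have := Nat.mul_le_mul hZ.1.le hY.2
    refine le_of_mul_le_mul_right ?_ huv
    nlinarith

lemma InWindow.ratio {p : Fin k → ℕ} (hp : ∀ i, 0 < p i) {u v v' : ℕ} {Y : Finset (Fin k)}
    (h : InWindow p u v Y) (h' : InWindow p u v' Y) : v' ≤ 16 * v := by
  have h0 := subProd_pos hp Yᶜ
  refine le_of_mul_le_mul_left ?_ h0
  have h1 := h'.2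
  have h2 := h.1
  nlinarith

lemma card_filter_sq_sum {α : Type*} (s : Finset α) (P : α → Prop) [DecidablePred P] :
    ((s.filter P).card : ℝ) ^ 2 = ∑ a ∈ s, ∑ b ∈ s, if P a ∧ P b then (1 : ℝ) else 0 := by
  have : ∀ a b, (if P a ∧ P b then (1 : ℝ) else 0) = (if P a then 1 else 0) * if P b then 1 else 0 := by
    intro a b; by_cases h1 : P a <;> by_cases h2 : P b <;> simp [h1, h2]
  simp_rw [this]
  rw [← Finset.sum_mul_sum, Finset.sum_boole, sq]

open Classical in
/-- The second moment method: many triples `(p, u, v)` have a pair of comparable divisors. -/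
lemma sum_window_ge (D : Fin k → Finset ℕ) (hD : ∀ i, ∀ p ∈ D i, 0 < p) (U V : Finset ℕ)
    (hU : ∀ u ∈ U, 0 < u) (l : ℕ) (hl : 2 ≤ l) (hV : ∀ v ∈ V, v.Prime ∧ l < v) (S M B : ℝ)
    (hS : S = ∏ i, ∑ x ∈ D i, (1 : ℝ) / x) (hS0 : 0 < S) (hB : 0 < B)
    (hU1 : 1 / 2 ≤ ∑ u ∈ U, (1 : ℝ) / u) (hU2 : ∑ u ∈ U, (1 : ℝ) / u ≤ 1)
    (hM : ∑ Y : Finset (Fin k), ∑ Z : Finset (Fin k),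
      ∑ p ∈ Fintype.piFinset D with CloseRatio p Y Z, tupWeight p ≤ S * M) (hM0 : 0 < M)
    (hlow : ∀ p ∈ Fintype.piFinset D, ∀ u ∈ U, ∀ Y : Finset (Fin k),
      B ≤ ∑ v ∈ V with InWindow p u v Y, (1 : ℝ) / v) :
    S * (2 ^ k * B / 2) ^ 2 * Real.log l / (16 * Real.log 4 * M) ≤
      ∑ p ∈ Fintype.piFinset D, ∑ u ∈ U, ∑ v ∈ V with ∃ Y, InWindow p u v Y,
        tupWeight p * (1 / u) * (1 / v) := by
  set Q := Fintype.piFinset D with hQ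
  have hl0 : 0 < Real.log l := Real.log_pos (by exact_mod_cast hl)
  have h4 : 0 < Real.log 4 := Real.log_pos (by norm_num)
  set W := Q ×ˢ (U ×ˢ V) with hW
  set w : (Fin k → ℕ) × (ℕ × ℕ) → ℝ := fun a => tupWeight a.1 * (1 / a.2.1) * (1 / a.2.2) with hw
  have hw0 : ∀ a, 0 ≤ w a := fun a => by
    have := tupWeight_nonneg a.1
    rw [hw]; positivity
  set R : (Fin k → ℕ) × (ℕ × ℕ) → ℝ := fun a =>
    ((Finset.univ.filter (fun Y => InWindow a.1 a.2.1 a.2.2 Y)).card : ℝ) with hR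
  have hT : ∑ p ∈ Q, ∑ u ∈ U, ∑ v ∈ V with ∃ Y, InWindow p u v Y,
        tupWeight p * (1 / u) * (1 / v) =
      ∑ a ∈ W, if ∃ Y, InWindow a.1 a.2.1 a.2.2 Y then w a else 0 := by
    rw [hW, Finset.sum_product]
    refine Finset.sum_congr rfl fun p _ => ?_
    rw [Finset.sum_product]
    refine Finset.sum_congr rfl fun u _ => ?_
    rw [Finset.sum_filter]
  have h1 : S * (2 ^ k * B / 2) ≤ ∑ a ∈ W, w a * R a := by
    have e1 : ∀ a, w a * R a = ∑ Y : Finset (Fin k), if InWindow a.1 a.2.1 a.2.2 Y then w a else 0 := by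
      intro a
      rw [← Finset.sum_filter, Finset.sum_const, nsmul_eq_mul, mul_comm]
    simp_rw [e1]
    rw [Finset.sum_comm]
    have e2 : ∀ Y : Finset (Fin k), S * (B / 2) ≤
        ∑ a ∈ W, if InWindow a.1 a.2.1 a.2.2 Y then w a else 0 := by
      intro Y
      rw [hW, Finset.sum_product, hS, ← sum_tupWeight, Finset.sum_mul]
      refine Finset.sum_le_sum fun p hp => ?_
      rw [Finset.sum_product]
      calc tupWeight p * (B / 2) ≤ tupWeight p * (B * ∑ u ∈ U, (1 : ℝ) / u) := by
            refine mul_le_mul_of_nonneg_left ?_ (tupWeight_nonneg p)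
            nlinarith
        _ = ∑ u ∈ U, tupWeight p * (1 / u) * B := by
            rw [mul_comm B, Finset.sum_mul, Finset.mul_sum]
            exact Finset.sum_congr rfl fun u _ => by ring
        _ ≤ _ := by
            refine Finset.sum_le_sum fun u hu => ?_
            rw [← Finset.sum_filter]
            simp only [hw]
            rw [← Finset.mul_sum]
            have := tupWeight_nonneg p
            exact mul_le_mul_of_nonneg_left (hlow p hp u hu Y) (by positivity)
    calc S * (2 ^ k * B / 2) = ∑ Y : Finset (Fin k), S * (B / 2) := by
          rw [Finset.sum_const, Finset.card_univ, Fintype.card_finset, Fintype.card_fin,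
            nsmul_eq_mul]
          push_cast; ring
      _ ≤ _ := Finset.sum_le_sum fun Y _ => e2 Y
  have h2 : ∑ a ∈ W, w a * R a ^ 2 ≤ 16 * Real.log 4 / Real.log l * (S * M) := by
    have e1 : ∀ a, w a * R a ^ 2 = ∑ Y : Finset (Fin k), ∑ Z : Finset (Fin k),
        if InWindow a.1 a.2.1 a.2.2 Y ∧ InWindow a.1 a.2.1 a.2.2 Z then w a else 0 := by
      intro a
      simp only [hR]
      rw [card_filter_sq_sum, Finset.mul_sum]
      refine Finset.sum_congr rfl fun Y _ => ?_
      rw [Finset.mul_sum]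
      refine Finset.sum_congr rfl fun Z _ => ?_
      rw [mul_ite, mul_one, mul_zero]
    simp_rw [e1]
    rw [Finset.sum_comm]
    refine le_trans ?_ (mul_le_mul_of_nonneg_left hM (by positivity))
    rw [Finset.mul_sum]
    refine Finset.sum_le_sum fun Y _ => ?_
    rw [Finset.sum_comm, Finset.mul_sum]
    refine Finset.sum_le_sum fun Z _ => ?_
    rw [hW, Finset.sum_product, Finset.sum_filter, Finset.mul_sum]
    refine Finset.sum_le_sum fun p hp => ?_
    rw [hQ, Fintype.mem_piFinset] at hp
    have hp0 : ∀ i, 0 < p i := fun i => hD i _ (hp i)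
    rw [Finset.sum_product]
    have hwt := tupWeight_nonneg p
    split_ifs with hc
    · calc _ ≤ ∑ u ∈ U, tupWeight p * (1 / u) * (16 * Real.log 4 / Real.log l) := by
            refine Finset.sum_le_sum fun u hu => ?_
            rw [← Finset.sum_filter]
            simp only [hw]
            rw [← Finset.mul_sum]
            refine mul_le_mul_of_nonneg_left ?_ (by positivity)
            refine sum_recip_le_of_ratio l hl _ (fun v hv => hV v (Finset.mem_filter.1 hv).1) ?_
            intro v hv v' hv'
            exact InWindow.ratio hp0 (Finset.mem_filter.1 hv).2.1 (Finset.mem_filter.1 hv').2.1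
        _ = 16 * Real.log 4 / Real.log l * tupWeight p * ∑ u ∈ U, (1 : ℝ) / u := by
            rw [Finset.mul_sum]
            exact Finset.sum_congr rfl fun u _ => by ring
        _ ≤ 16 * Real.log 4 / Real.log l * tupWeight p * 1 := by gcongr
        _ = _ := mul_one _
    · rw [mul_zero]
      refine (Finset.sum_eq_zero fun u hu => Finset.sum_eq_zero fun v hv => if_neg ?_).le
      rintro ⟨a1, a2⟩
      exact hc (a1.closeRatio (hU u hu) (hV v hv).1.pos a2)
  have h3 : (∑ a ∈ W, w a * R a) ^ 2 ≤
      (∑ a ∈ W, if ∃ Y, InWindow a.1 a.2.1 a.2.2 Y then w a else 0) * ∑ a ∈ W, w a * R a ^ 2 := by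
    refine Finset.sum_sq_le_sum_mul_sum_of_sq_le_mul W ?_ ?_ ?_
    · intro a _; split_ifs
      · exact hw0 a
      · exact le_rfl
    · intro a _; exact mul_nonneg (hw0 a) (sq_nonneg _)
    · intro a _
      split_ifs with hc
      · exact le_of_eq (by ring)
      · have : R a = 0 := by
          simp only [hR]
          rw [Finset.filter_false_of_mem]
          · simp
          · intro Y _ hY; exact hc ⟨Y, hY⟩
        rw [this]; exact le_of_eq (by ring)
  rw [hT]
  set X := ∑ a ∈ W, if ∃ Y, InWindow a.1 a.2.1 a.2.2 Y then w a else 0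
  have hX0 : 0 ≤ X := Finset.sum_nonneg fun a _ => by
    split_ifs
    · exact hw0 a
    · exact le_rfl
  have h5 : (S * (2 ^ k * B / 2)) ^ 2 ≤ X * (16 * Real.log 4 / Real.log l * (S * M)) :=
    (pow_le_pow_left₀ (by positivity) h1 2).trans (h3.trans (mul_le_mul_of_nonneg_left h2 hX0))
  rw [div_le_iff₀ (by positivity)]
  have h6 : (S * (2 ^ k * B / 2)) ^ 2 * Real.log l ≤ X * (16 * Real.log 4 * (S * M)) := by
    calc _ ≤ X * (16 * Real.log 4 / Real.log l * (S * M)) * Real.log l := by gcongr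
      _ = _ := by field_simp
  refine le_of_mul_le_mul_left ?_ hS0
  calc _ = (S * (2 ^ k * B / 2)) ^ 2 * Real.log l := by ring
    _ ≤ _ := h6
    _ = _ := by ring

end SecondMoment

lemma log_prod_le {C : ℝ} (hC : 0 ≤ C) (hlog : ∀ h, Real.log (blockEnd h) ≤ C * 2 ^ h) {k : ℕ}
    (f : Fin k → ZMod k) (hf : ∑ i, (2 : ℝ) ^ ((f i).val + 1) ≤ 32 * 2 ^ k) (p : Fin k → ℕ)
    (hp : ∀ i, p i ∈ block blockEnd (f i).val) :
    Real.log ((∏ i, p i : ℕ) : ℝ) ≤ 32 * C * 2 ^ k := by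
  have hp0 : ∀ i, 0 < p i := fun i => (mem_block.1 (hp i)).1.pos
  push_cast
  rw [Real.log_prod (fun i _ => by exact_mod_cast (hp0 i).ne')]
  calc ∑ i, Real.log (p i) ≤ ∑ i, C * 2 ^ ((f i).val + 1) := by
        refine Finset.sum_le_sum fun i _ => ?_
        have := mem_block.1 (hp i)
        refine le_trans (Real.log_le_log (by exact_mod_cast hp0 i)
          (by exact_mod_cast this.2.2)) (hlog _)
    _ = C * ∑ i, (2 : ℝ) ^ ((f i).val + 1) := by rw [Finset.mul_sum]
    _ ≤ C * (32 * 2 ^ k) := by gcongr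
    _ = _ := by ring

open Classical in
lemma exists_triples : ∃ c C : ℝ, 0 < c ∧ 0 < C ∧ ∀ k : ℕ, ∀ _ : NeZero k, ∃ U V : Finset ℕ,
    (∀ u ∈ U, u.Prime ∧ blockEnd k < u ∧ Real.log u ≤ C * 2 ^ k) ∧
    (∀ v ∈ V, v.Prime ∧ blockEnd k < v ∧ Real.log v ≤ C * 2 ^ k) ∧
    ∀ f : Fin k → ZMod k, ∑ i, (2 : ℝ) ^ ((f i).val + 1) ≤ 32 * 2 ^ k →
      c * Real.log 2 ^ k / cycWeight f ≤
        ∑ p ∈ Fintype.piFinset (fun i => block blockEnd (f i).val), ∑ u ∈ U,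
          ∑ v ∈ V with ∃ Y, InWindow p u v Y, tupWeight p * (1 / u) * (1 / v) := by
  obtain ⟨c1, C1, hc1, hC1, hlog⟩ := log_blockEnd
  have hg := Real.log_two_gt_d9
  have hl2 : 0 < Real.log 2 := by linarith
  have hl4 : 0 < Real.log 4 := Real.log_pos (by norm_num)
  have hl64 : 0 < Real.log (64 ^ 4) := Real.log_pos (by norm_num)
  obtain ⟨m, hm⟩ := pow_unbounded_of_one_lt ((33 * C1 + Real.log (64 ^ 4)) / c1)
    (show (1 : ℝ) < 2 by norm_num)
  rw [div_lt_iff₀ hc1] at hm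
  set K : ℝ := 32 * C1 + C1 * 2 ^ (m + 1) with hK
  have hK0 : 0 < K := by positivity
  set C : ℝ := max 1 (16 * Real.log 4 / Real.log 2 / c1) with hC
  have hCpos : 0 < C := lt_of_lt_of_le one_pos (le_max_left _ _)
  refine ⟨(1 / (16 * K)) ^ 2 * c1 / (32 * Real.log 4 * C), K + 3, by positivity, by positivity,
    fun k hk => ?_⟩
  have h2k : (1 : ℝ) ≤ 2 ^ k := one_le_pow₀ (by norm_num)
  set U := block blockEnd (k + m) with hU
  set V := (Nat.primesLE ⌊16 * Real.exp (K * 2 ^ k)⌋₊).filter (fun v => blockEnd k < v) with hV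
  have hbpos : ∀ h, (0 : ℝ) < blockEnd h := fun h => by
    have := blockEnd_pos h
    exact_mod_cast (by omega : 0 < blockEnd h)
  have hUup : ∀ u ∈ U, Real.log u ≤ C1 * 2 ^ (m + 1) * 2 ^ k := by
    intro u hu
    have hu' := mem_block.1 hu
    have h1 : Real.log u ≤ Real.log (blockEnd (k + m + 1)) :=
      Real.log_le_log (by exact_mod_cast hu'.1.pos) (by exact_mod_cast hu'.2.2)
    refine h1.trans ((hlog _).2.trans (le_of_eq ?_))
    ring
  have hUlow : ∀ u ∈ U, (33 * C1 + Real.log (64 ^ 4)) * 2 ^ k ≤ Real.log u := by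
    intro u hu
    have hu' := mem_block.1 hu
    have h1 : Real.log (blockEnd (k + m)) ≤ Real.log u :=
      Real.log_le_log (hbpos _) (by exact_mod_cast hu'.2.1.le)
    refine le_trans ?_ ((hlog _).1.trans h1)
    rw [pow_add]
    nlinarith
  refine ⟨U, V, ?_, ?_, ?_⟩
  · intro u hu
    have hu' := mem_block.1 hu
    refine ⟨hu'.1, lt_of_le_of_lt (blockEnd_strictMono.monotone (Nat.le_add_right k m)) hu'.2.1, ?_⟩
    refine (hUup u hu).trans ?_
    gcongr
    rw [hK]; linarith
  · intro v hv
    rw [hV, Finset.mem_filter, Nat.mem_primesLE, Nat.le_floor_iff (by positivity)] at hv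
    refine ⟨hv.1.2, hv.2, ?_⟩
    have hv0 : (0 : ℝ) < v := by exact_mod_cast hv.1.2.pos
    have h1 := Real.log_le_log hv0 hv.1.1
    rw [Real.log_mul (by norm_num) (Real.exp_pos _).ne', Real.log_exp,
      show (16 : ℝ) = 2 ^ 4 by norm_num, Real.log_pow] at h1
    have := Real.log_two_lt_d9
    push_cast at h1
    nlinarith
  · intro f hf
    set D : Fin k → Finset ℕ := fun i => block blockEnd (f i).val with hD
    set S := ∏ i, ∑ x ∈ D i, (1 : ℝ) / x with hS
    have hSge : Real.log 2 ^ k ≤ S := by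
      calc Real.log 2 ^ k = ∏ _i : Fin k, Real.log 2 := by simp
        _ ≤ S := Finset.prod_le_prod (fun i _ => hl2.le) fun i _ => sum_block_ge _
    have hS0 : 0 < S := lt_of_lt_of_le (by positivity) hSge
    have hF := cycWeight_pos f
    have hpair := sum_pairs_close_le f blockEnd C (le_max_left _ _)
      (fun h => by have := blockEnd_pos h; omega) sum_block_ge (by
        intro h
        calc 16 * Real.log 4 / Real.log 2 / Real.log (blockEnd h)
            ≤ 16 * Real.log 4 / Real.log 2 / (c1 * 2 ^ h) := by
              gcongr
              exact (hlog h).1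
          _ = 16 * Real.log 4 / Real.log 2 / c1 / 2 ^ h := by field_simp
          _ ≤ C / 2 ^ h := by gcongr; exact le_max_right _ _)
    have hDpos : ∀ i, ∀ p ∈ D i, 0 < p := fun i p hp => (mem_block.1 hp).1.pos
    have hlow : ∀ p ∈ Fintype.piFinset D, ∀ u ∈ U, ∀ Y : Finset (Fin k),
        1 / 8 / (K * 2 ^ k) ≤ ∑ v ∈ V with InWindow p u v Y, (1 : ℝ) / v := by
      intro p hp u hu Y
      rw [Fintype.mem_piFinset] at hp
      have hp0 : ∀ i, 0 < p i := fun i => hDpos i _ (hp i)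
      have hu0 : (0 : ℝ) < u := by exact_mod_cast (mem_block.1 hu).1.pos
      have ha : (0 : ℝ) < subProd p Y := by exact_mod_cast subProd_pos hp0 Y
      have hb : (0 : ℝ) < subProd p Yᶜ := by exact_mod_cast subProd_pos hp0 Yᶜ
      have ha1 : 0 ≤ Real.log (subProd p Y) := Real.log_natCast_nonneg _
      have hb1 : 0 ≤ Real.log (subProd p Yᶜ) := Real.log_natCast_nonneg _
      have hprod : Real.log (subProd p Y) + Real.log (subProd p Yᶜ) ≤ 32 * C1 * 2 ^ k := by
        rw [← Real.log_mul ha.ne' hb.ne', ← Nat.cast_mul, subProd_mul_compl]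
        exact log_prod_le hC1.le (fun h => (hlog h).2) f hf p hp
      set x : ℝ := subProd p Y * u / subProd p Yᶜ with hx
      have hx0 : 0 < x := by positivity
      have hlx : Real.log x = Real.log (subProd p Y) + Real.log u - Real.log (subProd p Yᶜ) := by
        rw [hx, Real.log_div (by positivity) hb.ne', Real.log_mul ha.ne' hu0.ne']
      have hlxlow : C1 * 2 ^ k + Real.log (64 ^ 4) ≤ Real.log x := by
        have h1 := hUlow u hu
        nlinarith
      have hlxup : Real.log x ≤ K * 2 ^ k := by
        have h1 := hUup u hu
        rw [hK]; linarith
      have hx64 : 64 ^ 4 ≤ x := by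
        rw [← Real.log_le_log_iff (by norm_num) hx0]
        have : 0 < C1 * 2 ^ k := by positivity
        linarith
      have hxl : (blockEnd k : ℝ) ≤ x := by
        rw [← Real.log_le_log_iff (hbpos k) hx0]
        have := (hlog k).2
        linarith
      have hlx0 : 0 < Real.log x := Real.log_pos (by linarith)
      refine le_trans ?_ (sum_recip_ge_of_window x hx64 _ ?_)
      · gcongr
      · intro v hv h1 h2
        rw [Finset.mem_filter, hV, Finset.mem_filter, Nat.mem_primesLE,
          Nat.le_floor_iff (by positivity)]
        refine ⟨⟨⟨h2.trans ?_, hv⟩, ?_⟩, ?_, ?_⟩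
        · gcongr
          rwa [← Real.log_le_iff_le_exp hx0]
        · exact_mod_cast lt_of_le_of_lt hxl h1
        · rw [hx, div_lt_iff₀ hb, mul_comm (v : ℝ)] at h1
          exact_mod_cast h1
        · rw [hx, ← mul_div_assoc, le_div_iff₀ hb, mul_comm (v : ℝ)] at h2
          exact_mod_cast h2
    have hfin := sum_window_ge D hDpos U V (fun u hu => (mem_block.1 hu).1.pos) (blockEnd k)
      (by have := blockEnd_pos k; omega)
      (fun v hv => by
        rw [hV, Finset.mem_filter, Nat.mem_primesLE] at hv
        exact ⟨hv.1.2, hv.2⟩)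
      S (2 * C * 2 ^ k * cycWeight f) (1 / 8 / (K * 2 ^ k)) rfl hS0 (by positivity)
      (by have := sum_block_ge (k + m); linarith) (sum_block_le _) hpair (by positivity) hlow
    refine le_trans ?_ hfin
    calc (1 / (16 * K)) ^ 2 * c1 / (32 * Real.log 4 * C) * Real.log 2 ^ k / cycWeight f
        ≤ (1 / (16 * K)) ^ 2 * c1 / (32 * Real.log 4 * C) * S / cycWeight f := by gcongr
      _ = S * (2 ^ k * (1 / 8 / (K * 2 ^ k)) / 2) ^ 2 * (c1 * 2 ^ k) /
          (16 * Real.log 4 * (2 * C * 2 ^ k * cycWeight f)) := by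
        field_simp
        norm_num
      _ ≤ _ := by
        gcongr
        exact (hlog k).1

lemma one_sub_sum_le_prod {ι : Type*} (s : Finset ι) (x : ι → ℝ) (h0 : ∀ i ∈ s, 0 ≤ x i)
    (h1 : ∀ i ∈ s, x i ≤ 1) : 1 - ∑ i ∈ s, x i ≤ ∏ i ∈ s, (1 - x i) := by
  classical
  induction s using Finset.induction_on with
  | empty => simp
  | insert a s ha ih =>
    rw [Finset.sum_insert ha, Finset.prod_insert ha]
    have ih' := ih (fun i hi => h0 i (Finset.mem_insert_of_mem hi))
      (fun i hi => h1 i (Finset.mem_insert_of_mem hi))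
    have ha0 := h0 a (Finset.mem_insert_self a s)
    have ha1 := h1 a (Finset.mem_insert_self a s)
    have hs : 0 ≤ ∑ i ∈ s, x i :=
      Finset.sum_nonneg fun i hi => h0 i (Finset.mem_insert_of_mem hi)
    nlinarith

lemma prod_totient_le {ι : Type*} (s : Finset ι) (p : ι → ℕ) :
    ∏ i ∈ s, Nat.totient (p i) ≤ Nat.totient (∏ i ∈ s, p i) := by
  classical
  induction s using Finset.induction_on with
  | empty => simp
  | insert a s ha ih =>
    rw [Finset.prod_insert ha, Finset.prod_insert ha]
    exact (Nat.mul_le_mul_left _ ih).trans (Nat.totient_super_multiplicative _ _)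

lemma totient_prime_cast {p : ℕ} (hp : p.Prime) : (Nat.totient p : ℝ) = p * (1 - 1 / p) := by
  have : (p : ℝ) ≠ 0 := by exact_mod_cast hp.ne_zero
  rw [Nat.totient_prime hp, Nat.cast_sub hp.one_le]
  field_simp
  simp

lemma totient_triple_ge {k : ℕ} (p : Fin k → ℕ) (hp : ∀ i, (p i).Prime)
    (hsum : ∑ i, (1 : ℝ) / p i ≤ 1 / 2) {u v : ℕ} (hu : u.Prime) (hv : v.Prime) (hu64 : 64 ≤ u)
    (hv64 : 64 ≤ v) :
    ((((∏ i, p i) * u * v : ℕ)) : ℝ) / 4 ≤ Nat.totient ((∏ i, p i) * u * v) := by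
  have h1 : (∏ i, Nat.totient (p i)) * Nat.totient u * Nat.totient v ≤
      Nat.totient ((∏ i, p i) * u * v) :=
    (Nat.mul_le_mul_right _ ((Nat.mul_le_mul_right _ (prod_totient_le _ p)).trans
      (Nat.totient_super_multiplicative _ _))).trans (Nat.totient_super_multiplicative _ _)
  have h2 : (((∏ i, Nat.totient (p i)) * Nat.totient u * Nat.totient v : ℕ) : ℝ) ≤
      Nat.totient ((∏ i, p i) * u * v) := by exact_mod_cast h1
  refine le_trans ?_ h2
  push_cast
  simp_rw [fun i => totient_prime_cast (hp i)]
  rw [totient_prime_cast hu, totient_prime_cast hv, Finset.prod_mul_distrib]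
  have h3 : (1 : ℝ) / 2 ≤ ∏ i, (1 - 1 / (p i : ℝ)) := by
    refine le_trans ?_ (one_sub_sum_le_prod Finset.univ (fun i => (1 : ℝ) / p i)
      (fun i _ => by positivity) fun i _ => ?_)
    · linarith
    · have : (1 : ℝ) ≤ p i := by exact_mod_cast (hp i).one_le
      rw [div_le_one (by linarith)]; exact this
  have h4 : ∀ w : ℕ, 64 ≤ w → (3 : ℝ) / 4 ≤ 1 - 1 / w := by
    intro w hw
    have : (1 : ℝ) / w ≤ 1 / 64 := one_div_le_one_div_of_le (by norm_num) (by exact_mod_cast hw)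
    linarith
  have h5 : (1 : ℝ) / 4 ≤ (∏ i, (1 - 1 / (p i : ℝ))) * (1 - 1 / u) * (1 - 1 / v) := by
    have hu' := h4 u hu64
    have hv' := h4 v hv64
    calc (1 : ℝ) / 4 ≤ 1 / 2 * (3 / 4) * (3 / 4) := by norm_num
      _ ≤ _ := by gcongr
  calc (∏ i, (p i : ℝ)) * u * v / 4 = ((∏ i, (p i : ℝ)) * u * v) * (1 / 4) := by ring
    _ ≤ ((∏ i, (p i : ℝ)) * u * v) *
        ((∏ i, (1 - 1 / (p i : ℝ))) * (1 - 1 / u) * (1 - 1 / v)) := by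
      gcongr
    _ = _ := by ring

lemma card_fiber_le {k : ℕ} (l : ℕ) (T : Finset ((Fin k → ℕ) × ℕ × ℕ))
    (hT : ∀ t ∈ T, (∀ i, (t.1 i).Prime ∧ t.1 i ≤ l) ∧ (t.2.1.Prime ∧ l < t.2.1) ∧
      (t.2.2.Prime ∧ l < t.2.2)) (q : ℕ) :
    (T.filter (fun t => (∏ i, t.1 i) * t.2.1 * t.2.2 = q)).card ≤ k.factorial * 2 := by
  set L1 := q.primeFactorsList.filter (fun p => p ≤ l) with hL1
  set L2 := q.primeFactorsList.filter (fun p => ¬ p ≤ l) with hL2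
  have key : ∀ t ∈ T.filter (fun t => (∏ i, t.1 i) * t.2.1 * t.2.2 = q),
      (List.ofFn t.1).Perm L1 ∧ [t.2.1, t.2.2].Perm L2 := by
    intro t ht
    rw [Finset.mem_filter] at ht
    obtain ⟨hp, hu, hv⟩ := hT t ht.1
    have hperm : (List.ofFn t.1 ++ [t.2.1, t.2.2]).Perm q.primeFactorsList := by
      refine Nat.primeFactorsList_unique ?_ ?_
      · rw [List.prod_append, List.prod_ofFn, ← ht.2]; simp [mul_assoc]
      · intro x hx
        rw [List.mem_append, List.mem_ofFn] at hx
        rcases hx with ⟨i, rfl⟩ | hx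
        · exact (hp i).1
        · simp only [List.mem_cons, List.not_mem_nil, or_false] at hx
          rcases hx with rfl | rfl
          · exact hu.1
          · exact hv.1
    have h1 := hperm.filter (fun p => decide (p ≤ l))
    have h2 := hperm.filter (fun p => decide (¬ p ≤ l))
    rw [List.filter_append] at h1 h2
    have a1 : (List.ofFn t.1).filter (fun p => decide (p ≤ l)) = List.ofFn t.1 := by
      rw [List.filter_eq_self]
      intro x hx
      obtain ⟨i, rfl⟩ := (List.mem_ofFn' _ _).1 hx
      simpa using (hp i).2
    have a2 : (List.ofFn t.1).filter (fun p => decide (¬ p ≤ l)) = [] := by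
      rw [List.filter_eq_nil_iff]
      intro x hx
      obtain ⟨i, rfl⟩ := (List.mem_ofFn' _ _).1 hx
      simpa using (hp i).2
    have b1 : [t.2.1, t.2.2].filter (fun p => decide (p ≤ l)) = [] := by
      simp [hu.2, hv.2]
    have b2 : [t.2.1, t.2.2].filter (fun p => decide (¬ p ≤ l)) = [t.2.1, t.2.2] := by
      simp [hu.2, hv.2]
    rw [a1, b1, List.append_nil] at h1
    rw [a2, b2, List.nil_append] at h2
    exact ⟨h1, h2⟩
  rcases (T.filter (fun t => (∏ i, t.1 i) * t.2.1 * t.2.2 = q)).eq_empty_or_nonempty with he | ⟨t0, ht0⟩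
  · rw [he]; simp
  have hlen1 : L1.length = k := by rw [← (key t0 ht0).1.length_eq, List.length_ofFn]
  have hlen2 : L2.length = 2 := by rw [← (key t0 ht0).2.length_eq]; rfl
  calc _ ≤ (L1.permutations.toFinset ×ˢ L2.permutations.toFinset).card := by
        refine Finset.card_le_card_of_injOn (fun t => (List.ofFn t.1, [t.2.1, t.2.2])) ?_ ?_
        · intro t ht
          have := key t ht
          simp only [Finset.coe_product, Set.mem_prod, Finset.mem_coe, List.mem_toFinset,
            List.mem_permutations]
          exact this
        · rintro ⟨p, u, v⟩ _ ⟨p', u', v'⟩ _ h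
          simp only [Prod.mk.injEq, List.cons.injEq, and_true] at h
          rw [List.ofFn_injective h.1, h.2.1, h.2.2]
    _ ≤ k.factorial * 2 := by
        rw [Finset.card_product]
        refine Nat.mul_le_mul ?_ ?_
        · refine (List.toFinset_card_le _).trans ?_
          rw [List.length_permutations, hlen1]
        · refine (List.toFinset_card_le _).trans ?_
          rw [List.length_permutations, hlen2]
          rfl

lemma factorial_le_stirling (k : ℕ) (hk : k ≠ 0) :
    (k.factorial : ℝ) ≤ Real.exp 1 * √k * (k / Real.exp 1) ^ k := by
  obtain ⟨n, rfl⟩ := Nat.exists_eq_succ_of_ne_zero hk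
  have h := Stirling.stirlingSeq'_antitone (Nat.zero_le n)
  simp only [Function.comp, Nat.succ_eq_add_one, zero_add] at h
  rw [Stirling.stirlingSeq_one, Stirling.stirlingSeq, div_le_iff₀ (by positivity),
    Real.sqrt_mul (by norm_num)] at h
  refine h.trans (le_of_eq ?_)
  field_simp

lemma sum_fin_pow_lt (k : ℕ) [NeZero k] (g : ℕ → ℝ) :
    ∑ h : ZMod k, g h.val = ∑ n ∈ Finset.range k, g n := by
  refine Finset.sum_bij (fun h _ => h.val) ?_ ?_ ?_ ?_
  · intro h _; exact Finset.mem_range.2 (ZMod.val_lt h)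
  · intro a _ b _ hab; exact ZMod.val_injective k hab
  · intro n hn
    exact ⟨(n : ZMod k), Finset.mem_univ _, ZMod.val_natCast_of_lt (Finset.mem_range.1 hn)⟩
  · intro h _; rfl

lemma block_disjoint {l : ℕ → ℕ} (hl : StrictMono l) {h h' p : ℕ} (hp : p ∈ block l h)
    (hp' : p ∈ block l h') : h = h' := by
  rw [mem_block] at hp hp'
  by_contra hne
  rcases Nat.lt_or_gt_of_ne hne with hlt | hlt
  · have := hl.monotone (Nat.succ_le_of_lt hlt)
    simp only [Nat.succ_eq_add_one] at this
    omega
  · have := hl.monotone (Nat.succ_le_of_lt hlt)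
    simp only [Nat.succ_eq_add_one] at this
    omega

/-- Integers of size about `exp (2 ^ k)` with a pair of comparable complementary divisors,
in number as large as the multiplication table problem allows. -/
lemma exists_comparable_divisors : ∃ c C c0 : ℝ, 0 < c ∧ 0 < C ∧ 0 < c0 ∧ ∀ k : ℕ, k ≠ 0 →
    ∃ A : Finset ℕ, (∀ q ∈ A, 0 < q ∧ c * 2 ^ k ≤ Real.log q ∧ Real.log q ≤ C * 2 ^ k ∧
      (q : ℝ) / 4 ≤ Nat.totient q ∧ ∃ d e : ℕ, q = d * e ∧ d < e ∧ e ≤ 16 * d) ∧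
      c0 * (Real.exp 1 * Real.log 2) ^ k / (k * √k) ≤ ∑ q ∈ A, (1 : ℝ) / q := by
  classical
  obtain ⟨c1, C1, hc1, hC1, hlog⟩ := log_blockEnd
  obtain ⟨c, C, hc, hC, htr⟩ := exists_triples
  refine ⟨c1, 32 * C1 + 2 * C, c / (4 * Real.exp 1), hc1, by positivity, by positivity,
    fun k hk => ?_⟩
  have hkz : NeZero k := ⟨hk⟩
  have hk0 : (0 : ℝ) < k := by exact_mod_cast Nat.pos_of_ne_zero hk
  have hl2 : 0 < Real.log 2 := Real.log_pos (by norm_num)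
  obtain ⟨U, V, hU, hV, hUV⟩ := htr k hkz
  set w : ZMod k → ℝ := fun h => 2 * (1 / (blockEnd h.val : ℝ)) + 2 ^ (h.val + 1) / (32 * 2 ^ k)
    with hw
  have hw1 : ∀ h, 0 ≤ 2 * (1 / (blockEnd h : ℝ)) := fun h => by positivity
  have hw2 : ∀ h : ℕ, (0 : ℝ) ≤ 2 ^ (h + 1) / (32 * 2 ^ k) := fun h => by positivity
  have hwsum : ∑ h, w h ≤ 1 / 4 := by
    have e1 := sum_fin_pow_lt k (fun n => 2 * (1 / (blockEnd n : ℝ)) + 2 ^ (n + 1) / (32 * 2 ^ k))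
    rw [hw, e1, Finset.sum_add_distrib, ← Finset.mul_sum, ← Finset.sum_div]
    simp_rw [pow_succ]
    rw [← Finset.sum_mul, geom_sum_eq (by norm_num)]
    have e2 := sum_inv_blockEnd k
    have e3 : ((2 : ℝ) ^ k - 1) / (2 - 1) * 2 / (32 * 2 ^ k) ≤ 1 / 16 := by
      have : (0 : ℝ) < 2 ^ k := by positivity
      rw [div_le_iff₀ (by positivity)]
      linarith
    linarith
  set G := Finset.univ.filter (fun f : Fin k → ZMod k => ∑ i, w (f i) ≤ 1) with hG
  have hgood := sum_good_cycWeight w (fun h => add_nonneg (hw1 _) (hw2 _)) hwsum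
  have hG1 : ∀ f ∈ G, ∑ i, 1 / (blockEnd (f i).val : ℝ) ≤ 1 / 2 := by
    intro f hf
    have h1 := (Finset.mem_filter.1 hf).2
    rw [hw, Finset.sum_add_distrib, ← Finset.mul_sum] at h1
    have h2 : 0 ≤ ∑ i, (2 : ℝ) ^ ((f i).val + 1) / (32 * 2 ^ k) :=
      Finset.sum_nonneg fun i _ => hw2 _
    linarith
  have hG2 : ∀ f ∈ G, ∑ i, (2 : ℝ) ^ ((f i).val + 1) ≤ 32 * 2 ^ k := by
    intro f hf
    have h1 := (Finset.mem_filter.1 hf).2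
    rw [hw, Finset.sum_add_distrib] at h1
    have h2 : 0 ≤ ∑ i, 2 * (1 / (blockEnd (f i).val : ℝ)) := Finset.sum_nonneg fun i _ => hw1 _
    have h3 : ∑ i, (2 : ℝ) ^ ((f i).val + 1) / (32 * 2 ^ k) ≤ 1 := by linarith
    rw [← Finset.sum_div, div_le_one (by positivity)] at h3
    exact h3
  set Tf : (Fin k → ZMod k) → Finset ((Fin k → ℕ) × ℕ × ℕ) := fun f =>
    ((Fintype.piFinset (fun i => block blockEnd (f i).val)) ×ˢ (U ×ˢ V)).filter
      (fun t => ∃ Y, InWindow t.1 t.2.1 t.2.2 Y) with hTf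
  set T := G.biUnion Tf with hT
  set Q : (Fin k → ℕ) × ℕ × ℕ → ℕ := fun t => (∏ i, t.1 i) * t.2.1 * t.2.2 with hQ
  have hTmem : ∀ t ∈ T, ∃ f ∈ G, (∀ i, t.1 i ∈ block blockEnd (f i).val) ∧ t.2.1 ∈ U ∧
      t.2.2 ∈ V ∧ ∃ Y, InWindow t.1 t.2.1 t.2.2 Y := by
    intro t ht
    rw [hT, Finset.mem_biUnion] at ht
    obtain ⟨f, hf, ht⟩ := ht
    rw [hTf, Finset.mem_filter, Finset.mem_product, Finset.mem_product, Fintype.mem_piFinset] at ht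
    exact ⟨f, hf, ht.1.1, ht.1.2.1, ht.1.2.2, ht.2⟩
  refine ⟨T.image Q, ?_, ?_⟩
  · intro q hq
    obtain ⟨⟨p, u, v⟩, ht, rfl⟩ := Finset.mem_image.1 hq
    obtain ⟨f, hf, hp, hu, hv, Y, hY⟩ := hTmem _ ht
    simp only at hp hu hv hY
    have hpp : ∀ i, (p i).Prime := fun i => (mem_block.1 (hp i)).1
    obtain ⟨hu1, hu2, hu3⟩ := hU u hu
    obtain ⟨hv1, hv2, hv3⟩ := hV v hv
    have hprod0 : 0 < ∏ i, p i := Finset.prod_pos fun i _ => (hpp i).pos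
    have hb : (0 : ℝ) < blockEnd k := by
      have := blockEnd_pos k
      exact_mod_cast (by omega : 0 < blockEnd k)
    have hlq : Real.log (((∏ i, p i) * u * v : ℕ) : ℝ) =
        Real.log ((∏ i, p i : ℕ) : ℝ) + Real.log u + Real.log v := by
      rw [Nat.cast_mul, Nat.cast_mul, Real.log_mul, Real.log_mul]
      · exact_mod_cast hprod0.ne'
      · exact_mod_cast hu1.ne_zero
      · exact_mod_cast (Nat.mul_pos hprod0 hu1.pos).ne'
      · exact_mod_cast hv1.ne_zero
    simp only [hQ]
    refine ⟨Nat.mul_pos (Nat.mul_pos hprod0 hu1.pos) hv1.pos, ?_, ?_, ?_,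
      subProd p Y * u, subProd p Yᶜ * v, ?_, hY.1, hY.2⟩
    · rw [hlq]
      have h1 : Real.log (blockEnd k) ≤ Real.log u := Real.log_le_log hb (by exact_mod_cast hu2.le)
      have h2 : 0 ≤ Real.log ((∏ i, p i : ℕ) : ℝ) := Real.log_natCast_nonneg _
      have h3 : 0 ≤ Real.log (v : ℝ) := Real.log_natCast_nonneg _
      linarith [(hlog k).1]
    · rw [hlq]
      have := log_prod_le hC1.le (fun h => (hlog h).2) f (hG2 f hf) p hp
      linarith
    · refine totient_triple_ge p hpp ?_ hu1 hv1 ((blockEnd_pos k).trans hu2.le)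
        ((blockEnd_pos k).trans hv2.le)
      refine (Finset.sum_le_sum fun i _ => ?_).trans (hG1 f hf)
      refine one_div_le_one_div_of_le ?_ (by exact_mod_cast (mem_block.1 (hp i)).2.1.le)
      have := blockEnd_pos (f i).val
      exact_mod_cast (by omega : 0 < blockEnd (f i).val)
    · rw [← subProd_mul_compl p Y]; ring
  · have hdisj : Set.PairwiseDisjoint (G : Set (Fin k → ZMod k)) Tf := by
      intro f _ g _ hfg
      rw [Function.onFun, Finset.disjoint_left]
      intro t htf htg
      rw [hTf, Finset.mem_filter, Finset.mem_product, Fintype.mem_piFinset] at htf htg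
      apply hfg
      funext i
      exact ZMod.val_injective k (block_disjoint blockEnd_strictMono (htf.1.1 i) (htg.1.1 i))
    have hsumT : c * Real.log 2 ^ k * (k : ℝ) ^ k / (2 * k) ≤ ∑ t ∈ T, (1 : ℝ) / Q t := by
      rw [hT, Finset.sum_biUnion hdisj]
      calc c * Real.log 2 ^ k * (k : ℝ) ^ k / (2 * k)
          ≤ c * Real.log 2 ^ k * (2 * k * ∑ f ∈ G, 1 / cycWeight f) / (2 * k) := by gcongr
        _ = ∑ f ∈ G, c * Real.log 2 ^ k / cycWeight f := by
            simp_rw [div_eq_mul_one_div (c * Real.log 2 ^ k)]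
            rw [← Finset.mul_sum]
            field_simp
        _ ≤ _ := by
            refine Finset.sum_le_sum fun f hf => (hUV f (hG2 f hf)).trans (le_of_eq ?_)
            rw [hTf, Finset.sum_filter, Finset.sum_product]
            refine Finset.sum_congr rfl fun p _ => ?_
            rw [Finset.sum_product]
            refine Finset.sum_congr rfl fun u _ => ?_
            rw [Finset.sum_filter]
            refine Finset.sum_congr rfl fun v _ => ?_
            refine if_congr Iff.rfl ?_ rfl
            simp only [hQ, tupWeight]
            push_cast
            rw [Finset.prod_div_distrib, Finset.prod_const_one]
            field_simp
    have hcomp := Finset.sum_comp (s := T) (fun q : ℕ => (1 : ℝ) / q) Q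
    rw [hcomp] at hsumT
    have hle : ∑ q ∈ T.image Q, (T.filter (fun t => Q t = q)).card • ((1 : ℝ) / q) ≤
        (k.factorial * 2 : ℝ) * ∑ q ∈ T.image Q, (1 : ℝ) / q := by
      rw [Finset.mul_sum]
      refine Finset.sum_le_sum fun q _ => ?_
      rw [nsmul_eq_mul]
      refine mul_le_mul_of_nonneg_right ?_ (by positivity)
      have := card_fiber_le (blockEnd k) T (by
        intro t ht
        obtain ⟨f, hf, hp, hu, hv, -⟩ := hTmem t ht
        refine ⟨fun i => ⟨(mem_block.1 (hp i)).1, (mem_block.1 (hp i)).2.2.trans ?_⟩,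
          ⟨(hU _ hu).1, (hU _ hu).2.1⟩, ⟨(hV _ hv).1, (hV _ hv).2.1⟩⟩
        exact blockEnd_strictMono.monotone (ZMod.val_lt (f i))) q
      exact_mod_cast this
    have h3 := hsumT.trans hle
    have hst := factorial_le_stirling k hk
    have h4 : 0 ≤ ∑ q ∈ T.image Q, (1 : ℝ) / q := Finset.sum_nonneg fun q _ => by positivity
    have h5 : c * Real.log 2 ^ k * (k : ℝ) ^ k / (2 * k) ≤
        (Real.exp 1 * √k * (k / Real.exp 1) ^ k * 2) * ∑ q ∈ T.image Q, (1 : ℝ) / q :=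
      h3.trans (by gcongr)
    have hsq : 0 < √(k : ℝ) := Real.sqrt_pos.2 hk0
    refine le_of_mul_le_mul_left (le_trans (le_of_eq ?_) h5)
      (show 0 < Real.exp 1 * √k * (k / Real.exp 1) ^ k * 2 by positivity)
    rw [div_pow, mul_pow]
    field_simp
    norm_num

/-- Second moment lower bound for a union of pairwise quasi-independent events. -/
lemma one_div_le_measureReal_biUnion {Ω ι : Type*} [MeasurableSpace Ω] (μ : Measure Ω)
    [IsProbabilityMeasure μ] (I : Finset ι) (E : ι → Set Ω) (hE : ∀ q, MeasurableSet (E q))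
    {K : ℝ} (hK : 0 ≤ K)
    (hpair : ∀ q ∈ I, ∀ r ∈ I, q ≠ r → μ.real (E q ∩ E r) ≤ K * (μ.real (E q) * μ.real (E r)))
    (hS : 1 ≤ ∑ q ∈ I, μ.real (E q)) :
    1 / (1 + K) ≤ μ.real (⋃ q ∈ I, E q) := by
  classical
  set S := ∑ q ∈ I, μ.real (E q) with hSdef
  set U := ⋃ q ∈ I, E q with hU
  have hUm : MeasurableSet U := Finset.measurableSet_biUnion _ fun q _ => hE q
  set s : ℝ := 1 / ((1 + K) * S) with hs
  have hS0 : 0 < S := by linarith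
  have hsum : ∑ q ∈ I, ∑ r ∈ I, μ.real (E q ∩ E r) ≤ (1 + K) * S ^ 2 := by
    have h1 : ∀ q ∈ I, ∑ r ∈ I, μ.real (E q ∩ E r) ≤ μ.real (E q) + K * (μ.real (E q) * S) := by
      intro q hq
      rw [← Finset.add_sum_erase I _ hq, Set.inter_self]
      gcongr
      calc ∑ r ∈ I.erase q, μ.real (E q ∩ E r)
          ≤ ∑ r ∈ I.erase q, K * (μ.real (E q) * μ.real (E r)) := by
            refine Finset.sum_le_sum fun r hr => ?_
            exact hpair q hq r (Finset.mem_of_mem_erase hr) (Finset.ne_of_mem_erase hr).symm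
        _ ≤ ∑ r ∈ I, K * (μ.real (E q) * μ.real (E r)) := by
            refine Finset.sum_le_sum_of_subset_of_nonneg (Finset.erase_subset _ _) ?_
            intros; positivity
        _ = K * (μ.real (E q) * S) := by rw [← Finset.mul_sum, ← Finset.mul_sum]
    calc _ ≤ ∑ q ∈ I, (μ.real (E q) + K * (μ.real (E q) * S)) := Finset.sum_le_sum h1
      _ = S + K * (S * S) := by
          rw [Finset.sum_add_distrib, ← Finset.mul_sum, ← Finset.sum_mul]
      _ ≤ _ := by nlinarith
  have hpt : ∀ x, 0 ≤ U.indicator (1 : Ω → ℝ) x - 2 * s * ∑ q ∈ I, (E q).indicator (1 : Ω → ℝ) x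
      + s ^ 2 * ∑ q ∈ I, ∑ r ∈ I, (E q ∩ E r).indicator (1 : Ω → ℝ) x := by
    intro x
    have hprod : ∑ q ∈ I, ∑ r ∈ I, (E q ∩ E r).indicator (1 : Ω → ℝ) x =
        (∑ q ∈ I, (E q).indicator (1 : Ω → ℝ) x) ^ 2 := by
      rw [sq, Finset.sum_mul_sum]
      refine Finset.sum_congr rfl fun q _ => Finset.sum_congr rfl fun r _ => ?_
      rw [Set.inter_indicator_one]; rfl
    rw [hprod]
    by_cases hx : x ∈ U
    · rw [Set.indicator_of_mem hx]
      simp only [Pi.one_apply]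
      nlinarith [sq_nonneg (1 - s * ∑ q ∈ I, (E q).indicator (1 : Ω → ℝ) x)]
    · have : ∑ q ∈ I, (E q).indicator (1 : Ω → ℝ) x = 0 := by
        refine Finset.sum_eq_zero fun q hq => ?_
        refine Set.indicator_of_notMem (fun h => hx ?_) _
        exact Set.mem_biUnion (Finset.mem_coe.2 hq) h
      rw [this, Set.indicator_of_notMem hx]
      simp
  have hexpand := integral_nonneg_of_ae (μ := μ) (Eventually.of_forall hpt)
  have hi : ∀ A : Set Ω, MeasurableSet A → Integrable (A.indicator (1 : Ω → ℝ)) μ :=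
    fun A hA => (integrable_const (1 : ℝ)).indicator hA
  have i1 : Integrable (fun x => ∑ q ∈ I, (E q).indicator (1 : Ω → ℝ) x) μ :=
    integrable_finsetSum _ fun q _ => hi _ (hE q)
  have i2 : Integrable (fun x => ∑ q ∈ I, ∑ r ∈ I, (E q ∩ E r).indicator (1 : Ω → ℝ) x) μ :=
    integrable_finsetSum _ fun q _ => integrable_finsetSum _ fun r _ =>
      hi _ ((hE q).inter (hE r))
  have i3 : Integrable (fun x => U.indicator (1 : Ω → ℝ) x -
      2 * s * ∑ q ∈ I, (E q).indicator (1 : Ω → ℝ) x) μ := (hi U hUm).sub (i1.const_mul _)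
  rw [integral_add i3 (i2.const_mul _),
    integral_sub (hi U hUm) (i1.const_mul _), integral_const_mul, integral_const_mul,
    integral_finsetSum _ (fun q _ => hi _ (hE q)),
    integral_finsetSum _ (fun q _ => integrable_finsetSum _ fun r _ =>
      hi _ ((hE q).inter (hE r))), integral_indicator_one hUm,
    Finset.sum_congr rfl (fun q _ => integral_indicator_one (hE q)),
    Finset.sum_congr rfl (fun q _ => (integral_finsetSum I (fun r _ =>
      hi _ ((hE q).inter (hE r)))).trans (Finset.sum_congr rfl fun r _ =>
        integral_indicator_one ((hE q).inter (hE r)))), ← hSdef] at hexpand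
  have h3 : s ^ 2 * ∑ q ∈ I, ∑ r ∈ I, μ.real (E q ∩ E r) ≤ 1 / (1 + K) := by
    calc _ ≤ s ^ 2 * ((1 + K) * S ^ 2) := by gcongr
      _ = 1 / (1 + K) := by rw [hs]; field_simp
  have h4 : 2 * s * S = 2 * (1 / (1 + K)) := by rw [hs]; field_simp
  linarith

/-- A point of the circle whose multiple by `n` vanishes is represented by a small fraction. -/
lemma exists_int_of_nsmul_eq_zero {n : ℕ} (hn : 0 < n) {w : UnitAddCircle} (hw : n • w = 0) :
    ∃ k : ℤ, w = ((k / n : ℝ) : UnitAddCircle) ∧ |(k : ℝ)| = n * ‖w‖ := by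
  obtain ⟨x, rfl⟩ := QuotientAddGroup.mk_surjective w
  change n • ((x : ℝ) : UnitAddCircle) = 0 at hw
  have hn' : (n : ℝ) ≠ 0 := by positivity
  rw [← AddCircle.coe_nsmul, AddCircle.coe_eq_zero_iff] at hw
  obtain ⟨j, hj⟩ := hw
  simp only [zsmul_eq_mul, mul_one, nsmul_eq_mul] at hj
  refine ⟨j - n * round x, ?_, ?_⟩
  · have h1 : (((j - n * round x : ℤ) : ℝ) / n) = x - (round x : ℤ) := by
      push_cast; rw [hj]; field_simp
    have h2 : ((((round x : ℤ) : ℝ)) : UnitAddCircle) = 0 :=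
      (AddCircle.coe_eq_zero_iff 1).2 ⟨round x, by simp⟩
    rw [h1, AddCircle.coe_sub, h2, sub_zero]
  · change _ = (n : ℝ) * ‖((x : ℝ) : UnitAddCircle)‖
    rw [UnitAddCircle.norm_eq]
    push_cast
    rw [hj, ← mul_sub, abs_mul, Nat.abs_cast]

lemma card_nsmul_eq_zero_near_le {n : ℕ} (hn : 0 < n) {t : ℝ} (ht : 0 ≤ t)
    (T : Finset UnitAddCircle) (hT : ∀ w ∈ T, n • w = 0 ∧ w ≠ 0 ∧ ‖w‖ < t) :
    (T.card : ℝ) ≤ 2 * (n * t) := by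
  classical
  have h : ∀ w : UnitAddCircle, ∃ k : ℤ, n • w = 0 →
      w = ((k / n : ℝ) : UnitAddCircle) ∧ |(k : ℝ)| = n * ‖w‖ := by
    intro w
    by_cases hw : n • w = 0
    · obtain ⟨k, hk⟩ := exists_int_of_nsmul_eq_zero hn hw
      exact ⟨k, fun _ => hk⟩
    · exact ⟨0, fun h => absurd h hw⟩
  choose f hf using h
  set M : ℤ := ⌊(n : ℝ) * t⌋ with hM
  have hM0 : 0 ≤ M := Int.floor_nonneg.2 (by positivity)
  have hcard : T.card ≤ ((Finset.Icc (-M) M).erase 0).card := by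
    refine Finset.card_le_card_of_injOn f ?_ ?_
    · intro w hw
      obtain ⟨h1, h2, h3⟩ := hT w hw
      obtain ⟨h4, h5⟩ := hf w h1
      have h6 : |f w| ≤ M := by
        rw [hM, Int.le_floor]; push_cast; rw [h5]; gcongr
      simp only [Finset.coe_erase, Finset.coe_Icc, Set.mem_sdiff, Set.mem_Icc,
        Set.mem_singleton_iff]
      refine ⟨abs_le.1 h6, fun h0 => h2 ?_⟩
      rw [h4, h0]; simp
    · intro w hw v hv hwv
      rw [(hf w (hT w hw).1).1, hwv, ← (hf v (hT v hv).1).1]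
  rw [Finset.card_erase_of_mem (by simp [hM0]), Int.card_Icc] at hcard
  have : (T.card : ℤ) ≤ 2 * M := by omega
  calc (T.card : ℝ) ≤ ((2 * M : ℤ) : ℝ) := by exact_mod_cast this
    _ ≤ _ := by push_cast; gcongr; exact Int.floor_le _

lemma card_nsmul_eq_zero_le {n : ℕ} (hn : 0 < n) (T : Finset UnitAddCircle)
    (hT : ∀ w ∈ T, n • w = 0) : T.card ≤ n := by
  classical
  have hsub : (T : Set UnitAddCircle) ⊆ {u : UnitAddCircle | n • u = 0} := fun w hw => hT w hw
  have h1 := AddCircle.card_torsion_le_of_isSMulRegular (1 : ℝ) n hn.ne'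
    (.of_right_eq_zero_of_smul fun _ ↦ by simp [hn.ne'])
  have h2 := (Set.encard_le_encard hsub).trans h1
  rw [Set.encard_coe_eq_coe_finsetCard] at h2
  exact_mod_cast h2

lemma card_close_pairs_le {q r : ℕ} (hq : 0 < q) (hr : 0 < r) (hqr : q ≠ r) {t : ℝ} (ht : 0 ≤ t)
    (P : Finset (UnitAddCircle × UnitAddCircle))
    (hP : ∀ u ∈ P, addOrderOf u.1 = q ∧ addOrderOf u.2 = r ∧ ‖u.1 - u.2‖ < t) :
    (P.card : ℝ) ≤ 2 * (q * r * t) := by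
  classical
  set W := P.image (fun u => u.1 - u.2) with hW
  have hg : 0 < Nat.gcd q r := Nat.gcd_pos_of_pos_left _ hq
  have hfib : ∀ w ∈ W, (P.filter (fun u => u.1 - u.2 = w)).card ≤ Nat.gcd q r := by
    intro w hw
    obtain ⟨u0, hu0, rfl⟩ := Finset.mem_image.1 hw
    set F := P.filter (fun u => u.1 - u.2 = u0.1 - u0.2) with hF
    have hinj : (F.image (fun u => u.1 - u0.1)).card = F.card := by
      refine Finset.card_image_of_injOn ?_
      intro u hu v hv huv
      have hu' := (Finset.mem_filter.1 hu).2
      have hv' := (Finset.mem_filter.1 hv).2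
      have h1 : u.1 = v.1 := sub_left_injective huv
      refine Prod.ext h1 ?_
      rw [← hv', h1] at hu'
      exact sub_right_injective hu'
    rw [← hinj]
    refine card_nsmul_eq_zero_le hg _ fun z hz => ?_
    obtain ⟨u, hu, rfl⟩ := Finset.mem_image.1 hz
    obtain ⟨huP, hu'⟩ := Finset.mem_filter.1 hu
    have h2 : u.1 - u0.1 = u.2 - u0.2 := by
      rw [sub_eq_sub_iff_add_eq_add] at hu' ⊢
      rw [hu', add_comm]
    obtain ⟨a1, a2, -⟩ := hP u huP
    obtain ⟨b1, b2, -⟩ := hP u0 hu0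
    refine addOrderOf_dvd_iff_nsmul_eq_zero.1 (Nat.dvd_gcd ?_ ?_)
    · refine addOrderOf_dvd_iff_nsmul_eq_zero.2 ?_
      rw [smul_sub, ← a1, addOrderOf_nsmul_eq_zero, a1, ← b1, addOrderOf_nsmul_eq_zero, sub_zero]
    · refine addOrderOf_dvd_iff_nsmul_eq_zero.2 ?_
      rw [h2, smul_sub, ← a2, addOrderOf_nsmul_eq_zero, a2, ← b2, addOrderOf_nsmul_eq_zero,
        sub_zero]
  have hWc : (W.card : ℝ) ≤ 2 * (Nat.lcm q r * t) := by
    refine card_nsmul_eq_zero_near_le (Nat.lcm_pos hq hr) ht W fun w hw => ?_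
    obtain ⟨u, hu, rfl⟩ := Finset.mem_image.1 hw
    obtain ⟨a1, a2, a3⟩ := hP u hu
    refine ⟨?_, ?_, a3⟩
    · rw [smul_sub, addOrderOf_dvd_iff_nsmul_eq_zero.1 (a1 ▸ Nat.dvd_lcm_left q r),
        addOrderOf_dvd_iff_nsmul_eq_zero.1 (a2 ▸ Nat.dvd_lcm_right q r), sub_zero]
    · intro h
      rw [sub_eq_zero] at h
      exact hqr (by rw [← a1, ← a2, h])
  have hPc : P.card ≤ Nat.gcd q r * W.card :=
    Finset.card_le_mul_card_image P _ hfib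
  calc (P.card : ℝ) ≤ Nat.gcd q r * W.card := by exact_mod_cast hPc
    _ ≤ Nat.gcd q r * (2 * (Nat.lcm q r * t)) := by gcongr
    _ = 2 * (((Nat.gcd q r * Nat.lcm q r : ℕ) : ℝ) * t) := by push_cast; ring
    _ = _ := by rw [Nat.gcd_mul_lcm]; push_cast; ring

lemma exists_finset_addOrderOf {q : ℕ} (hq : 0 < q) :
    ∃ T : Finset UnitAddCircle, (∀ u, u ∈ T ↔ addOrderOf u = q) ∧ T.card = Nat.totient q := by
  have hfin := AddCircle.finite_setOfPred_addOrderOf_eq (p := (1 : ℝ)) hq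
  refine ⟨hfin.toFinset, fun u => by simp, ?_⟩
  rw [← AddCircle.card_addOrderOf_eq_totient (p := (1 : ℝ)), ← Nat.card_eq_card_finite_toFinset]
  rfl

lemma volume_real_ball {δ : ℝ} (hδ : 0 ≤ δ) (u : UnitAddCircle) :
    (volume : Measure UnitAddCircle).real (Metric.ball u δ) = min 1 (2 * δ) := by
  rw [measureReal_def, ← measure_congr (AddCircle.closedBall_ae_eq_ball), AddCircle.volume_closedBall,
    ENNReal.toReal_ofReal (by positivity)]

lemma approxAddOrderOf_eq_biUnion {q : ℕ} (δ : ℝ) (T : Finset UnitAddCircle)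
    (hT : ∀ u, u ∈ T ↔ addOrderOf u = q) :
    approxAddOrderOf UnitAddCircle q δ = ⋃ u ∈ T, Metric.ball u δ := by
  ext x
  simp only [mem_approx_add_orderOf_iff, Set.mem_iUnion, hT, exists_prop]

lemma measurableSet_approxAddOrderOf (q : ℕ) (δ : ℝ) :
    MeasurableSet (approxAddOrderOf UnitAddCircle q δ) :=
  Metric.isOpen_thickening.measurableSet

lemma volume_real_approxAddOrderOf {q : ℕ} (hq : 0 < q) {δ : ℝ} (hδ : 0 ≤ δ)
    (hδq : 2 * q * δ ≤ 1) :
    (volume : Measure UnitAddCircle).real (approxAddOrderOf UnitAddCircle q δ) =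
      Nat.totient q * (2 * δ) := by
  obtain ⟨T, hT, hTc⟩ := exists_finset_addOrderOf hq
  have hq1 : (1 : ℝ) ≤ q := by exact_mod_cast hq
  have hdisj : (T : Set UnitAddCircle).PairwiseDisjoint (fun u => Metric.ball u δ) := by
    intro u hu v hv huv
    refine Metric.ball_disjoint_ball ?_
    have hu' := (hT u).1 hu
    have hv' := (hT v).1 hv
    have h0 : q • (u - v) = 0 := by
      rw [smul_sub, addOrderOf_dvd_iff_nsmul_eq_zero.1 (hu' ▸ dvd_rfl),
        addOrderOf_dvd_iff_nsmul_eq_zero.1 (hv' ▸ dvd_rfl), sub_zero]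
    obtain ⟨k, hk1, hk2⟩ := exists_int_of_nsmul_eq_zero hq h0
    have hk0 : k ≠ 0 := by
      rintro rfl
      exact huv (sub_eq_zero.1 (by rw [hk1]; simp))
    have hk3 : (1 : ℝ) ≤ |(k : ℝ)| := by exact_mod_cast Int.one_le_abs hk0
    rw [dist_eq_norm]
    rw [hk2] at hk3
    by_contra h
    push Not at h
    nlinarith
  rw [approxAddOrderOf_eq_biUnion δ T hT,
    measureReal_biUnion_finset hdisj (fun u _ => Metric.isOpen_ball.measurableSet),
    Finset.sum_congr rfl (fun u _ => volume_real_ball hδ u), Finset.sum_const, hTc, nsmul_eq_mul,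
    min_eq_right]
  nlinarith

lemma volume_real_inter_le {q r : ℕ} (hq : 0 < q) (hr : 0 < r) (hqr : q ≠ r) {δ ε : ℝ}
    (hδ : 0 ≤ δ) (hε : 0 ≤ ε) :
    (volume : Measure UnitAddCircle).real
      (approxAddOrderOf UnitAddCircle q δ ∩ approxAddOrderOf UnitAddCircle r ε) ≤
      8 * (q * δ * (r * ε)) := by
  classical
  obtain ⟨T, hT, -⟩ := exists_finset_addOrderOf hq
  obtain ⟨R, hR, -⟩ := exists_finset_addOrderOf hr
  set P := (T ×ˢ R).filter (fun u => ‖u.1 - u.2‖ < δ + ε) with hP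
  have hsub : approxAddOrderOf UnitAddCircle q δ ∩ approxAddOrderOf UnitAddCircle r ε ⊆
      ⋃ u ∈ P, (Metric.ball u.1 δ ∩ Metric.ball u.2 ε) := by
    rintro x ⟨hx1, hx2⟩
    rw [approxAddOrderOf_eq_biUnion δ T hT] at hx1
    rw [approxAddOrderOf_eq_biUnion ε R hR] at hx2
    simp only [Set.mem_iUnion, exists_prop] at hx1 hx2
    obtain ⟨u, hu, hxu⟩ := hx1
    obtain ⟨v, hv, hxv⟩ := hx2
    refine Set.mem_biUnion (x := (u, v)) ?_ ⟨hxu, hxv⟩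
    refine Finset.mem_filter.2 ⟨Finset.mk_mem_product hu hv, ?_⟩
    rw [← dist_eq_norm]
    calc dist u v ≤ dist x u + dist x v := dist_triangle_left _ _ _
      _ < δ + ε := add_lt_add hxu hxv
  have hPc : (P.card : ℝ) ≤ 2 * (q * r * (δ + ε)) := by
    refine card_close_pairs_le hq hr hqr (by positivity) P fun u hu => ?_
    obtain ⟨h1, h2⟩ := Finset.mem_filter.1 hu
    obtain ⟨h3, h4⟩ := Finset.mem_product.1 h1
    exact ⟨(hT _).1 h3, (hR _).1 h4, h2⟩
  have hb : ∀ u ∈ P, (volume : Measure UnitAddCircle).real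
      (Metric.ball u.1 δ ∩ Metric.ball u.2 ε) ≤ 2 * min δ ε := by
    intro u _
    rcases le_total δ ε with h | h
    · rw [min_eq_left h]
      refine (measureReal_mono Set.inter_subset_left).trans ?_
      rw [volume_real_ball hδ]; exact min_le_right _ _
    · rw [min_eq_right h]
      refine (measureReal_mono Set.inter_subset_right).trans ?_
      rw [volume_real_ball hε]; exact min_le_right _ _
  have hm : 0 ≤ min δ ε := le_min hδ hε
  calc _ ≤ (volume : Measure UnitAddCircle).real
        (⋃ u ∈ P, (Metric.ball u.1 δ ∩ Metric.ball u.2 ε)) := measureReal_mono hsub (measure_ne_top _ _)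
    _ ≤ ∑ u ∈ P, (volume : Measure UnitAddCircle).real
        (Metric.ball u.1 δ ∩ Metric.ball u.2 ε) := measureReal_biUnion_finset_le _ _
    _ ≤ ∑ u ∈ P, 2 * min δ ε := Finset.sum_le_sum hb
    _ = P.card * (2 * min δ ε) := by rw [Finset.sum_const, nsmul_eq_mul]
    _ ≤ 2 * (q * r * (δ + ε)) * (2 * min δ ε) := by gcongr
    _ ≤ 2 * (q * r * (2 * max δ ε)) * (2 * min δ ε) := by
        have : δ + ε ≤ 2 * max δ ε := by linarith [le_max_left δ ε, le_max_right δ ε]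
        gcongr
    _ = 8 * (q * r * (min δ ε * max δ ε)) := by ring
    _ = _ := by rw [min_mul_max]; ring

/-- Divergence half of the Duffin–Schaeffer theorem for approximation functions supported on
integers with large totient. -/
theorem ae_mem_addWellApproximable (ψ : ℕ → ℝ) (h0 : ∀ q, 0 ≤ ψ q) (h1 : ∀ q, ψ q ≤ 1 / 2)
    (hφ : ∀ q, ψ q ≠ 0 → 0 < q ∧ (q : ℝ) / 4 ≤ Nat.totient q) (hdiv : ¬ Summable ψ) :
    ∀ᵐ x : UnitAddCircle, x ∈ addWellApproximable UnitAddCircle (fun q => ψ q / q) := by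
  set δ : ℕ → ℝ := fun q => ψ q / q with hδ
  set E : ℕ → Set UnitAddCircle := fun q => approxAddOrderOf UnitAddCircle q (δ q) with hE
  set μ : Measure UnitAddCircle := volume
  have : IsProbabilityMeasure μ := ⟨UnitAddCircle.measure_univ⟩
  have hδ0 : ∀ q, 0 ≤ δ q := fun q => by have := h0 q; positivity
  have hqδ : ∀ q : ℕ, 0 < q → (q : ℝ) * δ q = ψ q := fun q hq => by
    simp only [hδ]; field_simp
  have hempty : ∀ q, ψ q = 0 → E q = ∅ := by
    intro q hq
    simp only [hE, hδ, hq, zero_div, approxAddOrderOf]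
    exact Metric.thickening_of_nonpos le_rfl _
  have hlow : ∀ q, ψ q / 2 ≤ μ.real (E q) := by
    intro q
    by_cases hq : ψ q = 0
    · rw [hq, zero_div]; exact measureReal_nonneg
    · obtain ⟨hq0, hq1⟩ := hφ q hq
      have hq' := hqδ q hq0
      rw [volume_real_approxAddOrderOf hq0 (hδ0 q) (by linarith [h1 q])]
      calc ψ q / 2 = q / 4 * (2 * δ q) := by rw [← hq']; ring
        _ ≤ _ := by have := hδ0 q; gcongr
  have hpair : ∀ q r, q ≠ r → μ.real (E q ∩ E r) ≤ 32 * (μ.real (E q) * μ.real (E r)) := by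
    intro q r hqr
    by_cases hq : ψ q = 0
    · simp [hempty q hq]
    by_cases hr : ψ r = 0
    · simp [hempty r hr]
    have hq0 := (hφ q hq).1
    have hr0 := (hφ r hr).1
    refine (volume_real_inter_le hq0 hr0 hqr (hδ0 q) (hδ0 r)).trans ?_
    rw [hqδ q hq0, hqδ r hr0]
    have := mul_le_mul (hlow q) (hlow r) (by linarith [h0 r]) measureReal_nonneg
    linarith
  have hmeas : ∀ q, MeasurableSet (E q) := fun q => measurableSet_approxAddOrderOf q _
  have htail : ∀ N, (1 : ℝ) / 33 ≤ μ.real (⋃ q ∈ Set.Ici N, E q) := by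
    intro N
    rw [not_summable_iff_tendsto_nat_atTop_of_nonneg h0] at hdiv
    obtain ⟨n, hn1, hn2⟩ := ((hdiv.eventually_ge_atTop
      (∑ q ∈ Finset.range N, ψ q + 2)).and (eventually_ge_atTop N)).exists
    have hS : 1 ≤ ∑ q ∈ Finset.Ico N n, μ.real (E q) := by
      calc (1 : ℝ) ≤ ∑ q ∈ Finset.Ico N n, ψ q / 2 := by
            rw [← Finset.sum_div, Finset.sum_Ico_eq_sub _ hn2]; linarith
        _ ≤ _ := Finset.sum_le_sum fun q _ => hlow q
    have := one_div_le_measureReal_biUnion μ (Finset.Ico N n) E hmeas (K := 32) (by norm_num)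
      (fun q _ r _ h => hpair q r h) hS
    calc (1 : ℝ) / 33 = 1 / (1 + 32) := by norm_num
      _ ≤ _ := this
      _ ≤ _ := by
        refine measureReal_mono (Set.biUnion_mono ?_ fun _ _ => le_rfl)
          (measure_ne_top _ _)
        intro q hq
        exact (Finset.mem_Ico.1 hq).1
  have hδlim : Tendsto δ atTop (nhds 0) := by
    have : Tendsto (fun q : ℕ => (1 : ℝ) / q) atTop (nhds 0) := tendsto_one_div_atTop_nhds_zero_nat
    refine squeeze_zero hδ0 (fun q => ?_) this
    simp only [hδ]
    have := h1 q
    gcongr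
    linarith
  rcases AddCircle.addWellApproximable_ae_empty_or_univ (T := (1 : ℝ)) δ hδlim with h | h
  swap
  · exact h
  exfalso
  set s : ℕ → Set UnitAddCircle := fun N => ⋃ q ∈ Set.Ici N, E q with hs
  have hsm : ∀ N, MeasurableSet (s N) := fun N =>
    MeasurableSet.biUnion (Set.to_countable _) fun q _ => hmeas q
  have hsa : Antitone s := fun M N hMN =>
    Set.biUnion_mono (Set.Ici_subset_Ici.2 hMN) fun _ _ => le_rfl
  have hlim := tendsto_measure_iInter_atTop (μ := μ) (fun N => (hsm N).nullMeasurableSet) hsa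
    ⟨0, measure_ne_top _ _⟩
  have hzero : μ (⋂ N, s N) = 0 := by
    refine measure_mono_null ?_ (ae_iff.1 h)
    intro x hx
    simp only [not_not, Set.mem_ofPred_eq]
    rw [UnitAddCircle.mem_addWellApproximable_iff]
    rw [← Nat.frequently_atTop_iff_infinite, frequently_atTop]
    intro N
    have hxN := Set.mem_iInter.1 hx (N + 1)
    simp only [hs, Set.mem_iUnion, Set.mem_Ici, exists_prop] at hxN
    obtain ⟨q, hq, hxq⟩ := hxN
    exact ⟨q, by omega, (UnitAddCircle.mem_approxAddOrderOf_iff (by omega)).1 hxq⟩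
  rw [hzero] at hlim
  have hge : ∀ N, ENNReal.ofReal (1 / 33) ≤ (μ ∘ s) N := fun N => by
    rw [Function.comp_apply, ENNReal.ofReal_le_iff_le_toReal (measure_ne_top _ _)]
    exact htail N
  have := ge_of_tendsto' hlim hge
  simp at this

/-- The exponent `1 - c` for the Erdős multiplication table constant `c`. -/
noncomputable def tableExp : ℝ := (1 + Real.log (Real.log 2)) / Real.log 2

lemma two_rpow_tableExp : (2 : ℝ) ^ tableExp = Real.exp 1 * Real.log 2 := by
  have h2 : 0 < Real.log 2 := Real.log_pos one_lt_two
  rw [Real.rpow_def_of_pos two_pos, tableExp, mul_div_cancel₀ _ h2.ne', Real.exp_add,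
    Real.exp_log h2]

lemma tableExp_nonneg : 0 ≤ tableExp := by
  have h2 : 0 < Real.log 2 := Real.log_pos one_lt_two
  have h3 : Real.exp (-1) ≤ Real.log 2 := by
    have := Real.log_two_gt_d9
    have h4 := Real.exp_one_gt_d9
    rw [Real.exp_neg, inv_le_comm₀ (Real.exp_pos 1) h2]
    calc (Real.log 2)⁻¹ ≤ 2 := by
          rw [inv_le_comm₀ h2 two_pos]; linarith
      _ ≤ _ := by linarith
  have := (Real.le_log_iff_exp_le h2).2 h3
  rw [tableExp]
  apply div_nonneg _ h2.le
  linarith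

lemma one_le_L (x : ℝ) : 1 ≤ L x := le_max_left _ _

lemma L_mono {x y : ℝ} (hx : 0 < x) (hxy : x ≤ y) : L x ≤ L y :=
  max_le_max le_rfl (Real.log_le_log hx hxy)

lemma L_le_self {x : ℝ} (hx : 1 ≤ x) : L x ≤ x :=
  max_le hx ((Real.log_le_sub_one_of_pos (by linarith)).trans (by linarith))

/-- The size of the approximation quality at denominator `q`, up to the factor `1 / q`. -/
noncomputable def weight (x : ℝ) : ℝ := L x ^ (-tableExp) * LL x ^ ((1 : ℝ) / 2)

lemma weight_nonneg (x : ℝ) : 0 ≤ weight x := by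
  have h1 := one_le_L x
  have h2 := one_le_L (L x)
  have h3 : 0 ≤ LL x := zero_le_one.trans h2
  unfold weight; positivity

lemma weight_le_self {x : ℝ} (hx : 1 ≤ x) : weight x ≤ x := by
  have h1 := one_le_L x
  have h2 : 1 ≤ LL x := one_le_L (L x)
  have h3 : LL x ≤ x := (L_le_self h1).trans (L_le_self hx)
  calc weight x ≤ 1 * LL x ^ (1 : ℝ) := by
        refine mul_le_mul ?_ ?_ (by positivity) zero_le_one
        · exact Real.rpow_le_one_of_one_le_of_nonpos h1 (by linarith [tableExp_nonneg])
        · exact Real.rpow_le_rpow_of_exponent_le h2 (by norm_num)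
    _ ≤ x := by rw [one_mul, Real.rpow_one]; exact h3

lemma weight_le_two_mul {x y : ℝ} (hy : 1 ≤ y) (hyx : y ≤ x) (hxy : x ≤ y ^ 2) :
    weight x ≤ 2 * weight y := by
  have hx1 := one_le_L x
  have hy1 := one_le_L y
  have hLL : 1 ≤ LL y := one_le_L (L y)
  have h1 : L x ≤ 2 * L y := by
    refine max_le (by linarith) ?_
    calc Real.log x ≤ Real.log (y ^ 2) := Real.log_le_log (by linarith) hxy
      _ = 2 * Real.log y := by rw [Real.log_pow]; norm_num
      _ ≤ _ := by gcongr; exact le_max_right _ _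
  have h2 : LL x ≤ 2 ^ 2 * LL y := by
    refine max_le (by linarith) ?_
    calc Real.log (L x) ≤ Real.log (2 * L y) := Real.log_le_log (by linarith) h1
      _ = Real.log 2 + Real.log (L y) := Real.log_mul two_ne_zero (by linarith)
      _ ≤ 1 + LL y := by
        gcongr
        · linarith [Real.log_two_lt_d9]
        · exact le_max_right _ _
      _ ≤ _ := by linarith
  have h3 : LL x ^ ((1 : ℝ) / 2) ≤ 2 * LL y ^ ((1 : ℝ) / 2) := by
    have hx2 : 1 ≤ LL x := one_le_L (L x)
    rw [← Real.sqrt_eq_rpow, ← Real.sqrt_eq_rpow]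
    calc √(LL x) ≤ √(2 ^ 2 * LL y) := Real.sqrt_le_sqrt h2
      _ = 2 * √(LL y) := by rw [Real.sqrt_mul (by norm_num), Real.sqrt_sq zero_le_two]
  have h4 : L x ^ (-tableExp) ≤ L y ^ (-tableExp) :=
    Real.rpow_le_rpow_of_nonpos (by linarith) (L_mono (by linarith) hyx)
      (by linarith [tableExp_nonneg])
  have hx2 : 1 ≤ LL x := one_le_L (L x)
  calc weight x ≤ L y ^ (-tableExp) * (2 * LL y ^ ((1 : ℝ) / 2)) := by
        unfold weight; gcongr
    _ = _ := by unfold weight; ring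

lemma exists_le_weight {c C : ℝ} (hc : 0 < c) (hC : 0 < C) :
    ∃ κ : ℝ, 0 < κ ∧ ∀ (k : ℕ) (x : ℝ), c * 2 ^ k ≤ Real.log x → Real.log x ≤ C * 2 ^ k →
      κ * √k / (Real.exp 1 * Real.log 2) ^ k ≤ weight x := by
  set D := max 0 (-Real.log c) with hD
  have hD0 : 0 ≤ D := le_max_left _ _
  have hD1 : -Real.log c ≤ D := le_max_right _ _
  refine ⟨(1 + C) ^ (-tableExp) * √(1 / (2 * (1 + D))), by positivity, fun k x h1 h2 => ?_⟩
  have hp : (1 : ℝ) ≤ 2 ^ k := one_le_pow₀ one_le_two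
  have hL1 := one_le_L x
  have hLL1 : 1 ≤ LL x := one_le_L (L x)
  have hLup : L x ≤ (1 + C) * 2 ^ k := max_le (by nlinarith) (by nlinarith)
  have hLL : 1 / (2 * (1 + D)) * k ≤ LL x := by
    have h3 : (k : ℝ) * Real.log 2 + Real.log c ≤ LL x := by
      calc _ = Real.log (c * 2 ^ k) := by
            rw [Real.log_mul hc.ne' (by positivity), Real.log_pow]; ring
        _ ≤ Real.log (L x) := Real.log_le_log (by positivity) (h1.trans (le_max_right _ _))
        _ ≤ _ := le_max_right _ _
    have h4 : (k : ℝ) * (1 / 2) ≤ k * Real.log 2 := by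
      gcongr; linarith [Real.log_two_gt_d9]
    have h5 : (k : ℝ) * (1 / 2) ≤ (1 + D) * LL x := by nlinarith
    rw [div_mul_eq_mul_div, div_le_iff₀ (by positivity)]
    linarith
  have h6 : √(1 / (2 * (1 + D))) * √k ≤ LL x ^ ((1 : ℝ) / 2) := by
    rw [← Real.sqrt_eq_rpow, ← Real.sqrt_mul (by positivity)]
    exact Real.sqrt_le_sqrt hLL
  have h7 : (1 + C) ^ (-tableExp) / (Real.exp 1 * Real.log 2) ^ k ≤ L x ^ (-tableExp) := by
    calc _ = ((1 + C) * 2 ^ k) ^ (-tableExp) := by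
          rw [Real.mul_rpow (by positivity) (by positivity), ← two_rpow_tableExp,
            ← Real.rpow_natCast (2 ^ tableExp), ← Real.rpow_natCast 2, ← Real.rpow_mul zero_le_two,
            ← Real.rpow_mul zero_le_two, div_eq_mul_inv, ← Real.rpow_neg zero_le_two]
          congr 2
          ring
      _ ≤ _ := Real.rpow_le_rpow_of_nonpos (by linarith) hLup (by linarith [tableExp_nonneg])
  have hlog : 0 < Real.log 2 := Real.log_pos one_lt_two
  calc _ = (1 + C) ^ (-tableExp) / (Real.exp 1 * Real.log 2) ^ k *
        (√(1 / (2 * (1 + D))) * √k) := by ring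
    _ ≤ _ := by unfold weight; gcongr

lemma not_summable_of_sum_blocks {ψ : ℕ → ℝ} (h0 : ∀ q, 0 ≤ ψ q) {c C K : ℝ} (hc : 0 < c)
    (hK : 0 < K)
    (h : ∀ k : ℕ, k ≠ 0 → ∃ A : Finset ℕ, (∀ q ∈ A, c * 2 ^ k ≤ Real.log q ∧
      Real.log q ≤ C * 2 ^ k) ∧ K / k ≤ ∑ q ∈ A, ψ q) : ¬ Summable ψ := by
  intro hsum
  obtain ⟨m, hm⟩ := pow_unbounded_of_one_lt (C / c) (one_lt_two (α := ℝ))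
  rw [div_lt_iff₀ hc] at hm
  have h' : ∀ i : ℕ, ∃ A : Finset ℕ, (∀ q ∈ A, c * 2 ^ ((m + 1) * (i + 1)) ≤ Real.log q ∧
      Real.log q ≤ C * 2 ^ ((m + 1) * (i + 1))) ∧
      K / ((m + 1) * (i + 1) : ℕ) ≤ ∑ q ∈ A, ψ q := fun i => h _ (by positivity)
  choose A hA hAs using h'
  have hdisj : ∀ i j, i < j → Disjoint (A i) (A j) := by
    intro i j hij
    rw [Finset.disjoint_left]
    intro q hi hj
    have h1 := (hA i q hi).2
    have h2 := (hA j q hj).1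
    have h3 : (2 : ℝ) ^ (m + (m + 1) * (i + 1)) ≤ 2 ^ ((m + 1) * (j + 1)) := by
      refine pow_le_pow_right₀ one_le_two ?_
      nlinarith
    have h4 : C * 2 ^ ((m + 1) * (i + 1)) < c * 2 ^ (m + (m + 1) * (i + 1)) := by
      rw [pow_add, ← mul_assoc]
      gcongr
      linarith
    have h5 := mul_le_mul_of_nonneg_left h3 hc.le
    linarith
  have hs : Summable (fun i => ∑ q ∈ A i, ψ q) := by
    refine summable_of_sum_range_le (c := ∑' q, ψ q) (fun i => Finset.sum_nonneg fun q _ => h0 q)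
      fun n => ?_
    rw [← Finset.sum_biUnion]
    · exact hsum.sum_le_tsum _ fun q _ => h0 q
    · intro i _ j _ hij
      rcases lt_or_gt_of_ne hij with h | h
      · exact hdisj i j h
      · exact (hdisj j i h).symm
  have hs2 : Summable (fun i : ℕ => K / (m + 1) * (1 / ((i + 1 : ℕ) : ℝ))) := by
    refine Summable.of_nonneg_of_le (fun i => by positivity) (fun i => ?_) hs
    refine le_trans (le_of_eq ?_) (hAs i)
    push_cast
    field_simp
  rw [summable_mul_left_iff (by positivity)] at hs2
  exact Real.not_summable_one_div_natCast ((summable_nat_add_iff 1).1 hs2)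

/-- Integers with large totient that are products of two distinct comparable factors. -/
def IsBalanced (q : ℕ) : Prop :=
  0 < q ∧ (q : ℝ) / 4 ≤ Nat.totient q ∧ ∃ d e : ℕ, q = d * e ∧ d < e ∧ e ≤ 16 * d

open Classical in
/-- The approximation function attached to the squares. -/
noncomputable def approxFun (q : ℕ) : ℝ :=
  if IsBalanced q then 1 / 2312 * weight q / q else 0

lemma approxFun_nonneg (q : ℕ) : 0 ≤ approxFun q := by
  unfold approxFun
  split_ifs
  · have := weight_nonneg q
    positivity
  · exact le_rfl

lemma approxFun_le_half (q : ℕ) : approxFun q ≤ 1 / 2 := by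
  unfold approxFun
  split_ifs with h
  · have hq : (1 : ℝ) ≤ q := by exact_mod_cast h.1
    have := weight_le_self hq
    rw [div_le_iff₀ (by linarith)]
    linarith
  · norm_num

lemma not_summable_approxFun : ¬ Summable approxFun := by
  obtain ⟨c, C, c0, hc, hC, hc0, hA⟩ := exists_comparable_divisors
  obtain ⟨κ, hκ, hw⟩ := exists_le_weight hc hC
  refine not_summable_of_sum_blocks approxFun_nonneg (c := c) (C := C)
    (K := 1 / 2312 * κ * c0) hc (by positivity) fun k hk => ?_
  obtain ⟨A, hA1, hA2⟩ := hA k hk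
  refine ⟨A, fun q hq => ⟨(hA1 q hq).2.1, (hA1 q hq).2.2.1⟩, ?_⟩
  have hlog : 0 < Real.log 2 := Real.log_pos one_lt_two
  have hk0 : (0 : ℝ) < k := by exact_mod_cast Nat.pos_of_ne_zero hk
  set B := Real.exp 1 * Real.log 2 with hB
  have hB0 : 0 < B := by positivity
  calc 1 / 2312 * κ * c0 / k =
        1 / 2312 * (κ * √k / B ^ k) * (c0 * B ^ k / (k * √k)) := by
        have : 0 < √(k : ℝ) := Real.sqrt_pos.2 hk0
        field_simp
    _ ≤ 1 / 2312 * (κ * √k / B ^ k) * ∑ q ∈ A, (1 : ℝ) / q := by gcongr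
    _ = ∑ q ∈ A, 1 / 2312 * (κ * √k / B ^ k) / q := by
        rw [Finset.mul_sum]
        exact Finset.sum_congr rfl fun q _ => by ring
    _ ≤ _ := by
        refine Finset.sum_le_sum fun q hq => ?_
        obtain ⟨h1, h2, h3, h4, h5⟩ := hA1 q hq
        rw [approxFun, if_pos ⟨h1, h4, h5⟩]
        have := hw k q h2 h3
        gcongr

lemma nint_le_of_norm_lt {q : ℕ} (hq : 0 < q) {α t : ℝ} {m : ℕ}
    (h : ‖((α : ℝ) : UnitAddCircle) - ((m / q : ℝ) : UnitAddCircle)‖ < t / q) (n : ℕ) :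
    nint ((n * q : ℝ) * α) ≤ n * t := by
  rw [← AddCircle.coe_sub, UnitAddCircle.norm_eq] at h
  set j := round (α - m / q)
  have hq' : (0 : ℝ) < q := by exact_mod_cast hq
  calc nint ((n * q : ℝ) * α) ≤ |n * q * α - ((n * (m + q * j) : ℤ) : ℝ)| := round_le _ _
    _ = |(n : ℝ) * (q * (α - m / q - j))| := by
        congr 1
        push_cast
        field_simp
        ring
    _ = n * (q * |α - m / q - j|) := by
        rw [abs_mul, abs_mul, Nat.abs_cast, Nat.abs_cast]
    _ ≤ n * (q * (t / q)) := by gcongr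
    _ = n * t := by field_simp

lemma deltaMin_le {a : ℕ → ℕ} {α : ℝ} {N m n : ℕ} (hm : 1 ≤ m) (hmN : m ≤ N) (hn : 1 ≤ n)
    (hnN : n ≤ N) (hmn : m ≠ n) : deltaMin a α N ≤ nint (((a m : ℝ) - (a n : ℝ)) * α) := by
  refine csInf_le ⟨0, ?_⟩ ⟨m, n, hm, hmN, hn, hnN, hmn, rfl⟩
  rintro x ⟨_, _, -, -, -, -, -, rfl⟩
  exact abs_nonneg _

lemma exists_deltaMin_sq_le {q : ℕ} (hq : 289 ≤ q) {α : ℝ} {m : ℕ}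
    (h : ‖((α : ℝ) : UnitAddCircle) - ((m / q : ℝ) : UnitAddCircle)‖ < approxFun q / q) :
    ∃ N : ℕ, q ≤ N ^ 2 ∧ deltaMin (fun n => n ^ 2) α N ≤ weight N / (N : ℝ) ^ 2 := by
  have hpos : 0 < approxFun q := by
    have h1 := (norm_nonneg _).trans_lt h
    have hq' : (0 : ℝ) < q := by exact_mod_cast (by omega : 0 < q)
    exact (div_pos_iff_of_pos_right hq').1 h1
  have hbal : IsBalanced q := by
    by_contra hb
    rw [approxFun, if_neg hb] at hpos
    exact lt_irrefl _ hpos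
  obtain ⟨hq0, -, d, e, hde, hlt, hle⟩ := id hbal
  have hd : 0 < d := Nat.pos_of_ne_zero fun h0 => by simp [h0] at hde; omega
  have hN1 : 4 * q ≤ (d + e) ^ 2 := by
    rw [hde]; nlinarith [sq_nonneg ((d : ℤ) - e), mul_self_nonneg ((e - d : ℕ) : ℤ),
      Nat.add_sub_of_le hlt.le, four_mul_le_sq_add d e]
  have hN2 : (d + e) ^ 2 ≤ 289 * q := by
    rw [hde]; nlinarith
  have hN3 : d + e ≤ q := by
    by_contra hlt'
    push Not at hlt'
    nlinarith
  refine ⟨d + e, by omega, ?_⟩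
  have hδ := deltaMin_le (a := fun n => n ^ 2) (α := α) (N := d + e) (m := d + e) (n := e - d)
    (by omega) le_rfl (by omega) (by omega) (by omega)
  have hcast : (((d + e) ^ 2 : ℕ) : ℝ) - (((e - d) ^ 2 : ℕ) : ℝ) = ((4 : ℕ) : ℝ) * q := by
    rw [hde]; push_cast [Nat.cast_sub hlt.le]; ring
  refine hδ.trans ?_
  simp only [hcast]
  refine (nint_le_of_norm_lt hq0 h 4).trans ?_
  rw [approxFun, if_pos hbal]
  have hN1r : ((d + e : ℕ) : ℝ) ^ 2 ≤ 289 * q := by exact_mod_cast hN2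
  have hw : weight q ≤ 2 * weight (d + e : ℕ) := by
    refine weight_le_two_mul ?_ ?_ ?_
    · exact_mod_cast (by omega : 1 ≤ d + e)
    · exact_mod_cast hN3
    · exact_mod_cast (by omega : q ≤ (d + e) ^ 2)
  have hq' : (0 : ℝ) < q := by exact_mod_cast hq0
  have hNpos : (0 : ℝ) < ((d + e : ℕ) : ℝ) := by exact_mod_cast (by omega : 0 < d + e)
  have hw0 := weight_nonneg (d + e : ℕ)
  rw [le_div_iff₀ (by positivity)]
  calc ((4 : ℕ) : ℝ) * (1 / 2312 * weight q / q) * ((d + e : ℕ) : ℝ) ^ 2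
      ≤ ((4 : ℕ) : ℝ) * (1 / 2312 * (2 * weight (d + e : ℕ)) / q) * (289 * q) := by gcongr
    _ = weight (d + e : ℕ) := by push_cast; field_simp; ring

theorem ae_frequently_deltaMin_sq_le :
    ∀ᵐ α ∂(volume : Measure ℝ), α ∈ Set.Icc (0 : ℝ) 1 →
      ∃ᶠ N : ℕ in atTop, deltaMin (fun n => n ^ 2) α N ≤ weight N / (N : ℝ) ^ 2 := by
  have hae := ae_mem_addWellApproximable approxFun approxFun_nonneg approxFun_le_half
    (fun q hq => by
      by_cases hb : IsBalanced q
      · exact ⟨hb.1, hb.2.1⟩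
      · exact absurd (if_neg hb) hq) not_summable_approxFun
  have h1 := (UnitAddCircle.measurePreserving_mk 0).quasiMeasurePreserving.ae hae
  rw [zero_add, Measure.restrict_congr_set Ioc_ae_eq_Icc, ae_restrict_iff' measurableSet_Icc] at h1
  filter_upwards [h1] with α hα hα01
  have hinf := (UnitAddCircle.mem_addWellApproximable_iff _ _).1 (hα hα01)
  rw [← Nat.frequently_atTop_iff_infinite, frequently_atTop] at hinf
  rw [frequently_atTop]
  intro M
  obtain ⟨q, hq, m, -, -, hm⟩ := hinf (max 289 (M ^ 2))
  obtain ⟨N, hN1, hN2⟩ := exists_deltaMin_sq_le ((le_max_left _ _).trans hq) hm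
  refine ⟨N, ?_, hN2⟩
  have : M ^ 2 ≤ N ^ 2 := ((le_max_right _ _).trans hq).trans hN1
  exact (Nat.pow_le_pow_iff_left two_ne_zero).1 this

end SquareDiff

theorem stmt10 :
    ∀ᵐ α ∂(volume : Measure ℝ), α ∈ Set.Icc (0 : ℝ) 1 →
      ∃ᶠ N in atTop,
        deltaMin (fun n => n ^ 2) α N ≤
          (L N) ^ (1 - (1 + Real.log (Real.log 2)) / Real.log 2 - 1) *
            (LL N) ^ ((1 : ℝ) / 2) / (N : ℝ) ^ 2 := by
  have hexp : (1 - (1 + Real.log (Real.log 2)) / Real.log 2 - 1) = -SquareDiff.tableExp := by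
    unfold SquareDiff.tableExp; ring
  rw [hexp]
  exact SquareDiff.ae_frequently_deltaMin_sq_le
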